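/- If a datum (c,d,B) is gaussian-extremizable, then D(c,d,B) = D_g(c,d,B). -/

import Mathlib

open MeasureTheory LinearMap
open scoped RealInnerProductSpace BigOperators NNReal ENNReal

noncomputable section

namespace FRBL

/-- A positive semidefinite (self-adjoint) operator on a real inner product space. -/
def PosSemidef {G : Type*} [NormedAddCommGroup G] [InnerProductSpace ℝ G]
    (A : G →ₗ[ℝ] G) : Prop :=
  A.IsSymmetric ∧ ∀ x : G, 0 ≤ ⟪A x, x⟫

/-- A positive definite (self-adjoint) operator on a real inner product space. -/
def PosDef {G : Type*} [NormedAddCommGroup G] [InnerProductSpace ℝ G]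
    (A : G →ₗ[ℝ] G) : Prop :=
  A.IsSymmetric ∧ ∀ x : G, x ≠ 0 → 0 < ⟪A x, x⟫

variable {k m : ℕ}
  (E : Fin k → Type*) (F : Fin m → Type*)
  [∀ i, NormedAddCommGroup (E i)] [∀ i, InnerProductSpace ℝ (E i)]
  [∀ i, FiniteDimensional ℝ (E i)]
  [∀ i, MeasurableSpace (E i)] [∀ i, BorelSpace (E i)]
  [∀ j, NormedAddCommGroup (F j)] [∀ j, InnerProductSpace ℝ (F j)]
  [∀ j, FiniteDimensional ℝ (F j)]
  [∀ j, MeasurableSpace (F j)] [∀ j, BorelSpace (F j)]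
  (c : Fin k → ℝ) (d : Fin m → ℝ)
  (B : ∀ i j, E i →ₗ[ℝ] F j)

/-- The pointwise domination hypothesis of the forward-reverse Brascamp-Lieb inequality. -/
def Hyp (f : ∀ i, E i → ℝ≥0) (g : ∀ j, F j → ℝ≥0) : Prop :=
  ∀ x : ∀ i, E i,
    (∏ i, f i (x i) ^ c i) ≤ ∏ j, g j (∑ i, c i • B i j (x i)) ^ d j

/-- `D₀` is an admissible constant for the forward-reverse Brascamp-Lieb inequality. -/
def IsBound (D₀ : ℝ) : Prop :=
  ∀ (f : ∀ i, E i → ℝ≥0) (g : ∀ j, F j → ℝ≥0),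
    (∀ i, Measurable (f i)) → (∀ j, Measurable (g j)) →
    Hyp E F c d B f g →
    (∏ i, (∫⁻ x, (f i x : ℝ≥0∞)) ^ c i) ≤
      ENNReal.ofReal (Real.exp D₀) * ∏ j, (∫⁻ y, (g j y : ℝ≥0∞)) ^ d j

/-- The best constant `D(c,d,B)` in the forward-reverse Brascamp-Lieb inequality. -/
def D : EReal :=
  sInf {x : EReal | ∃ D₀ : ℝ, x = (D₀ : EReal) ∧ IsBound E F c d B D₀}

/-- The gaussian constraint `Λ_c B* U_d B Λ_c ≤ V_c`, written via quadratic forms. -/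
def GaussCon (V : ∀ i, E i →ₗ[ℝ] E i) (U : ∀ j, F j →ₗ[ℝ] F j) : Prop :=
  ∀ x : ∀ i, E i,
    (∑ j, d j * ⟪U j (∑ i, c i • B i j (x i)), ∑ i, c i • B i j (x i)⟫) ≤
      ∑ i, c i * ⟪V i (x i), x i⟫

/-- The objective functional in the definition of the gaussian constant. -/
def gaussObj (V : ∀ i, E i →ₗ[ℝ] E i) (U : ∀ j, F j →ₗ[ℝ] F j) : ℝ :=
  (∑ j, d j * Real.log (LinearMap.det (U j)) -
    ∑ i, c i * Real.log (LinearMap.det (V i))) / 2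

/-- The gaussian best constant `D_g(c,d,B)`. -/
def Dg : EReal :=
  sSup {x : EReal | ∃ (V : ∀ i, E i →ₗ[ℝ] E i) (U : ∀ j, F j →ₗ[ℝ] F j),
    (∀ i, PosDef (V i)) ∧ (∀ j, PosDef (U j)) ∧ GaussCon E F c d B V U ∧
    x = (gaussObj E F c d V U : EReal)}

/-- The datum `(c,d,B)` is gaussian-extremizable: the supremum defining `D_g` is
finite and attained. -/
def GaussExt : Prop :=
  ∃ (V : ∀ i, E i →ₗ[ℝ] E i) (U : ∀ j, F j →ₗ[ℝ] F j),
    (∀ i, PosDef (V i)) ∧ (∀ j, PosDef (U j)) ∧ GaussCon E F c d B V U ∧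
    Dg E F c d B = (gaussObj E F c d V U : EReal)

/-- The canonical linear equivalence between `E₀ = ⊕ᵢ Eᵢ` (as `PiLp 2`) and the pi type. -/
def toPi : PiLp 2 E ≃ₗ[ℝ] ∀ i, E i := WithLp.linearEquiv 2 ℝ (∀ i, E i)

/-- Orthogonal projection `π_{E_i} : E₀ → E_i`. -/
def projL (i : Fin k) : PiLp 2 E →ₗ[ℝ] E i := (LinearMap.proj i).comp (toPi E).toLinearMap

/-- The embedding `E_i → E₀`. -/
def singleL (i : Fin k) : E i →ₗ[ℝ] PiLp 2 E :=
  (toPi E).symm.toLinearMap.comp (LinearMap.single ℝ E i)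

/-- The map `B_j : E₀ → E^j`, `x ↦ ∑ᵢ B_{ij} π_{E_i} x`. -/
def Bop (j : Fin m) : PiLp 2 E →ₗ[ℝ] F j := ∑ i, (B i j).comp (projL E i)

/-- `Λ_c = ⊕ᵢ cᵢ id_{E_i}` as an operator on `E₀`. -/
def Lam : PiLp 2 E →ₗ[ℝ] PiLp 2 E := ∑ i, c i • (singleL E i).comp (projL E i)

/-- The set `Π(A_1, …, A_k)` of positive semidefinite "couplings". -/
def Coupling (A : ∀ i, E i →ₗ[ℝ] E i) : Set (PiLp 2 E →ₗ[ℝ] PiLp 2 E) :=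
  {P | PosSemidef P ∧ ∀ (i : Fin k) (v : E i),
    ⟪P (singleL E i v), singleL E i v⟫ = ⟪A i v, v⟫}

/-- The scaling condition `∑ᵢ cᵢ dim Eᵢ = ∑ⱼ dⱼ dim E^j`. -/
def ScalingCond : Prop :=
  ∑ i, c i * (Module.finrank ℝ (E i) : ℝ) = ∑ j, d j * (Module.finrank ℝ (F j) : ℝ)

/-- A subspace `T ⊆ E₀` is of product form, i.e. `T = ⊕ᵢ π_{E_i} T`. -/
def ProductForm (T : Submodule ℝ (PiLp 2 E)) : Prop :=
  ∀ x ∈ T, ∀ i, singleL E i (projL E i x) ∈ T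

/-- The dimension condition over product-form subspaces. -/
def DimCond : Prop :=
  ∀ T : Submodule ℝ (PiLp 2 E), ProductForm E T →
    (∑ i, c i * (Module.finrank ℝ (T.map (projL E i)) : ℝ)) ≤
      ∑ j, d j * (Module.finrank ℝ (T.map (Bop E F B j)) : ℝ)

/-- A critical subspace. -/
def IsCritical (T : Submodule ℝ (PiLp 2 E)) : Prop :=
  T ≠ ⊥ ∧ T ≠ ⊤ ∧ ProductForm E T ∧
    ∑ i, c i * (Module.finrank ℝ (T.map (projL E i)) : ℝ) =
      ∑ j, d j * (Module.finrank ℝ (T.map (Bop E F B j)) : ℝ)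

/-- The datum is simple if it has no critical subspace. -/
def Simple : Prop := ∀ T : Submodule ℝ (PiLp 2 E), ¬ IsCritical E F c d B T

end FRBL

namespace FRBL

/-- `log det` with value `−∞` on operators with non-positive determinant
(in particular on singular positive-semidefinite operators). -/
def elogdet {G : Type*} [AddCommGroup G] [Module ℝ G] (A : G →ₗ[ℝ] G) : EReal :=
  if 0 < LinearMap.det A then ((Real.log (LinearMap.det A) : ℝ) : EReal) else ⊥

variable {k m : ℕ}
  (E : Fin k → Type*) (F : Fin m → Type*)
  [∀ i, NormedAddCommGroup (E i)] [∀ i, InnerProductSpace ℝ (E i)]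
  [∀ i, FiniteDimensional ℝ (E i)]
  [∀ j, NormedAddCommGroup (F j)] [∀ j, InnerProductSpace ℝ (F j)]
  [∀ j, FiniteDimensional ℝ (F j)]
  (c : Fin k → ℝ) (d : Fin m → ℝ)
  (B : ∀ i j, E i →ₗ[ℝ] F j)

/-- The map `Q_j := B_j Λ_c : E₀ → E^j`. -/
def BLam (j : Fin m) : PiLp 2 E →ₗ[ℝ] F j := (Bop E F B j).comp (Lam E c)

/-- The optimality condition of Theorem 2 (structure of gaussian extremizers):
each `B_j Λ_c Π Λ_c B_j*` is invertible and
`∑ⱼ dⱼ Λ_c B_j* (B_j Λ_c Π Λ_c B_j*)⁻¹ B_j Λ_c ≤ V_c` in the quadratic-form sense. -/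
def ExtCond (V : ∀ i, E i →ₗ[ℝ] E i) (P : PiLp 2 E →ₗ[ℝ] PiLp 2 E) : Prop :=
  (∀ j, IsUnit ((BLam E F c B j) ∘ₗ P ∘ₗ LinearMap.adjoint (BLam E F c B j))) ∧
  ∀ x : PiLp 2 E,
    (∑ j, d j * ⟪Ring.inverse ((BLam E F c B j) ∘ₗ P ∘ₗ LinearMap.adjoint (BLam E F c B j))
        (BLam E F c B j x), BLam E F c B j x⟫) ≤
      ∑ i, c i * ⟪V i (projL E i x), projL E i x⟫

/-- A geometric datum. -/
def Geometric : Prop :=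
  ScalingCond E F c d ∧
  ∃ S ∈ Coupling E (fun i => (LinearMap.id : E i →ₗ[ℝ] E i)),
    (∀ j, (BLam E F c B j) ∘ₗ S ∘ₗ LinearMap.adjoint (BLam E F c B j) = LinearMap.id) ∧
    ∀ x : PiLp 2 E, (∑ j, d j * ⟪BLam E F c B j x, BLam E F c B j x⟫) ≤ ⟪Lam E c x, x⟫

/-- Equivalence of data: `B'_j = C_j⁻¹ B_j C⁻¹` for invertible `C, C_j`. -/
def EquivData (B' : ∀ i j, E i →ₗ[ℝ] F j) : Prop :=
  ∃ (C : PiLp 2 E ≃ₗ[ℝ] PiLp 2 E) (Cj : ∀ j, F j ≃ₗ[ℝ] F j),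
    ∀ j, Bop E F B' j =
      ((Cj j).symm.toLinearMap ∘ₗ Bop E F B j) ∘ₗ C.symm.toLinearMap

/-- `V_c = ⊕ᵢ cᵢ Vᵢ` as an operator on `E₀`. -/
def blockDiag (V : ∀ i, E i →ₗ[ℝ] E i) : PiLp 2 E →ₗ[ℝ] PiLp 2 E :=
  ∑ i, c i • ((singleL E i) ∘ₗ (V i)) ∘ₗ (projL E i)

/-- `Θ = V_c − ∑ⱼ dⱼ Λ_c B_j* U_j B_j Λ_c`. -/
def Theta (V : ∀ i, E i →ₗ[ℝ] E i) (U : ∀ j, F j →ₗ[ℝ] F j) :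
    PiLp 2 E →ₗ[ℝ] PiLp 2 E :=
  blockDiag E c V -
    ∑ j, d j • (LinearMap.adjoint (BLam E F c B j) ∘ₗ (U j)) ∘ₗ (BLam E F c B j)

end FRBL

namespace FRBL

/-- Borel structure on submodules (inherited from the ambient space). -/
instance subBorel {G : Type*} [AddCommGroup G] [Module ℝ G] [TopologicalSpace G]
    [MeasurableSpace G] [BorelSpace G] (T : Submodule ℝ G) : BorelSpace ↥T :=
  Subtype.borelSpace (T : Set G)

/-- The maximal dimension of a subspace on which the self-adjoint operator `Q` is positive
definite; by Sylvester's law of inertia this is the number of positive eigenvalues of `Q`,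
counted with multiplicity. -/
def posIndex {H : Type*} [NormedAddCommGroup H] [InnerProductSpace ℝ H]
    (Q : H →ₗ[ℝ] H) : ℕ :=
  sSup {r : ℕ | ∃ W : Submodule ℝ H,
    (∀ x ∈ W, x ≠ 0 → 0 < ⟪Q x, x⟫) ∧ Module.finrank ℝ W = r}

/-- The standard gaussian probability measure on a Euclidean space. -/
def stdGaussian (G : Type*) [NormedAddCommGroup G] [InnerProductSpace ℝ G]
    [FiniteDimensional ℝ G] [MeasurableSpace G] [BorelSpace G] :
    Measure G :=
  volume.withDensity fun x =>
    ENNReal.ofReal ((2 * Real.pi) ^ (-(Module.finrank ℝ G : ℝ) / 2) *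
      Real.exp (-‖x‖ ^ 2 / 2))

/-- `K_s = (|s|^{1/s} |s'|^{1/s'})^{1/2}`. -/
def Kconst (s s' : ℝ) : ℝ := Real.sqrt (|s| ^ (1 / s) * |s'| ^ (1 / s'))

variable {k m : ℕ}
  (E : Fin k → Type*) (F : Fin m → Type*)
  [∀ i, NormedAddCommGroup (E i)] [∀ i, InnerProductSpace ℝ (E i)]
  [∀ i, FiniteDimensional ℝ (E i)]
  [∀ j, NormedAddCommGroup (F j)] [∀ j, InnerProductSpace ℝ (F j)]
  [∀ j, FiniteDimensional ℝ (F j)]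
  (c : Fin k → ℝ) (d : Fin m → ℝ)
  (B : ∀ i j, E i →ₗ[ℝ] F j)

/-- The objective functional `∑ⱼ dⱼ log det Uⱼ − ∑ᵢ cᵢ log det Vᵢ`. -/
def objective (V : ∀ i, E i →ₗ[ℝ] E i) (U : ∀ j, F j →ₗ[ℝ] F j) : ℝ :=
  ∑ j, d j * Real.log (LinearMap.det (U j)) - ∑ i, c i * Real.log (LinearMap.det (V i))

/-- Feasibility for the optimization problem defining `D_g`: positive definiteness
together with the constraint `Θ ≥ 0`. -/
def Admissible (V : ∀ i, E i →ₗ[ℝ] E i) (U : ∀ j, F j →ₗ[ℝ] F j) : Prop :=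
  (∀ i, PosDef (V i)) ∧ (∀ j, PosDef (U j)) ∧ PosSemidef (Theta E F c d B V U)

/-- Global maximality in the optimization problem defining `D_g`. -/
def IsGlobalMax (V : ∀ i, E i →ₗ[ℝ] E i) (U : ∀ j, F j →ₗ[ℝ] F j) : Prop :=
  Admissible E F c d B V U ∧
    ∀ V' U', Admissible E F c d B V' U' →
      objective E F c d V' U' ≤ objective E F c d V U

/-- Local maximality in the optimization problem defining `D_g`. -/
def IsLocalMax (V : ∀ i, E i →ₗ[ℝ] E i) (U : ∀ j, F j →ₗ[ℝ] F j) : Prop :=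
  Admissible E F c d B V U ∧
    ∃ ε : ℝ, 0 < ε ∧
      ∀ V' U', Admissible E F c d B V' U' →
        (∀ i, ‖LinearMap.toContinuousLinearMap (V' i - V i)‖ < ε) →
        (∀ j, ‖LinearMap.toContinuousLinearMap (U' j - U j)‖ < ε) →
        objective E F c d V' U' ≤ objective E F c d V U

end FRBL

namespace FRBL

section Gaussian

open ProbabilityTheory (IsGaussian)

variable {G : Type*} [NormedAddCommGroup G] [InnerProductSpace ℝ G] [FiniteDimensional ℝ G]
  [MeasurableSpace G] [BorelSpace G]

variable (G) in
/-- Mathlib's standard gaussian measure, equal to `FRBL.stdGaussian` (`stdGaussian_eq_gauss`). -/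
abbrev gauss : Measure G := ProbabilityTheory.stdGaussian G

lemma integrable_exp_neg_half_sq :
    Integrable (fun x : G => Real.exp (-‖x‖ ^ 2 / 2)) := by
  refine Integrable.of_integral_ne_zero ?_
  have h := GaussianFourier.integral_rexp_neg_mul_sq_norm (V := G) (b := 1 / 2) (by norm_num)
  have e : (fun x : G => Real.exp (-‖x‖ ^ 2 / 2)) = fun x => Real.exp (-(1 / 2) * ‖x‖ ^ 2) := by
    ext x; congr 1; ring
  rw [e, h]
  positivity

lemma integral_stdGaussian_eq {H : Type*} [NormedAddCommGroup H] [NormedSpace ℝ H] (F : G → H) :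
    ∫ z, F z ∂(stdGaussian G) = ∫ z, ((2 * Real.pi) ^ (-(Module.finrank ℝ G : ℝ) / 2) *
      Real.exp (-‖z‖ ^ 2 / 2)) • F z := by
  have hm : Measurable fun x : G => Real.toNNReal
      ((2 * Real.pi) ^ (-(Module.finrank ℝ G : ℝ) / 2) * Real.exp (-‖x‖ ^ 2 / 2)) := by
    fun_prop
  rw [stdGaussian]
  simp only [ENNReal.ofReal]
  rw [integral_withDensity_eq_integral_smul hm]
  refine integral_congr_ae (Filter.Eventually.of_forall fun z => ?_)
  simp only [NNReal.smul_def]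
  rw [Real.coe_toNNReal _ (by positivity)]

instance : IsFiniteMeasure (stdGaussian G) := by
  refine isFiniteMeasure_withDensity_ofReal ?_
  exact (integrable_exp_neg_half_sq.const_mul _).2

lemma stdGaussian_eq_gauss : stdGaussian G = gauss G := by
  refine Measure.ext_of_charFun ?_
  ext t
  rw [ProbabilityTheory.charFun_stdGaussian, charFun_apply, integral_stdGaussian_eq]
  have h := GaussianFourier.integral_cexp_neg_mul_sq_norm_add (V := G) (b := 1 / 2) (by norm_num)
    Complex.I t
  have hpi : (0 : ℝ) < 2 * Real.pi := by positivity
  calc _ = ∫ z : G, (((2 * Real.pi) ^ (-(Module.finrank ℝ G : ℝ) / 2) : ℝ) : ℂ) *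
        Complex.exp (-(1 / 2) * ‖z‖ ^ 2 + Complex.I * ⟪t, z⟫) := by
        congr 1; ext z
        rw [Complex.exp_add, real_inner_comm]
        simp only [Complex.real_smul]
        push_cast
        rw [← mul_assoc, mul_comm Complex.I, show -(‖z‖ : ℂ) ^ 2 / 2 = -(1 / 2) * (‖z‖ : ℂ) ^ 2 by
          ring]
    _ = _ := by
        rw [integral_const_mul, h, Complex.ofReal_cpow hpi.le, ← mul_assoc]
        have : ((Real.pi : ℂ) / (1 / 2)) = ((2 * Real.pi : ℝ) : ℂ) := by push_cast; ring
        rw [this, ← Complex.cpow_add _ _ (by exact_mod_cast hpi.ne')]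
        have e : ((-(Module.finrank ℝ G : ℝ) / 2 : ℝ) : ℂ) + (Module.finrank ℝ G : ℂ) / 2 = 0 := by
          push_cast; ring
        rw [e, Complex.cpow_zero, one_mul]
        congr 1
        simp
        ring

lemma integral_gauss {H : Type*} [NormedAddCommGroup H] [NormedSpace ℝ H] (F : G → H) :
    ∫ z, F z ∂(gauss G) = ∫ z, ((2 * Real.pi) ^ (-(Module.finrank ℝ G : ℝ) / 2) *
      Real.exp (-‖z‖ ^ 2 / 2)) • F z := by
  rw [← stdGaussian_eq_gauss, integral_stdGaussian_eq]

/-- Cameron–Martin formula. -/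
lemma integral_gauss_shift (F : G → ℝ) (a : G) :
    ∫ z, F z ∂(gauss G) = ∫ z, F (z + a) * Real.exp (-⟪a, z⟫ - ‖a‖ ^ 2 / 2) ∂(gauss G) := by
  rw [integral_gauss, integral_gauss, ← integral_add_right_eq_self _ a]
  congr 1; ext z
  have : -‖z + a‖ ^ 2 / 2 = -‖z‖ ^ 2 / 2 + (-⟪a, z⟫ - ‖a‖ ^ 2 / 2) := by
    rw [norm_add_sq_real, real_inner_comm]; ring
  rw [this, Real.exp_add]
  simp only [smul_eq_mul]; ring

lemma integrable_exp_norm_gauss (C : ℝ) :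
    Integrable (fun z : G => Real.exp (C * ‖z‖)) (gauss G) := by
  obtain ⟨c, hc, hi⟩ := IsGaussian.exists_integrable_exp_sq (gauss G)
  refine (hi.const_mul (Real.exp (C ^ 2 / (4 * c)))).mono' (by fun_prop)
    (Filter.Eventually.of_forall fun z => ?_)
  rw [Real.norm_of_nonneg (Real.exp_pos _).le, ← Real.exp_add]
  refine Real.exp_le_exp.2 ?_
  have h : 0 ≤ (C / (2 * c) - ‖z‖) ^ 2 * c := by positivity
  have e : (C / (2 * c) - ‖z‖) ^ 2 * c = C ^ 2 / (4 * c) + c * ‖z‖ ^ 2 - C * ‖z‖ := by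
    field_simp; ring
  linarith

lemma map_gauss_of_adjoint {H : Type*} [NormedAddCommGroup H] [InnerProductSpace ℝ H]
    [FiniteDimensional ℝ H] [MeasurableSpace H] [BorelSpace H] (A : H →ₗ[ℝ] G)
    (hA : ∀ t, ‖LinearMap.adjoint A t‖ = ‖t‖) : (gauss H).map A = gauss G := by
  have hc : Continuous A := A.continuous_of_finiteDimensional
  have : IsProbabilityMeasure ((gauss H).map A) := Measure.isProbabilityMeasure_map
    hc.aemeasurable
  refine Measure.ext_of_charFun ?_
  ext t
  rw [ProbabilityTheory.charFun_stdGaussian, charFun_apply, integral_map hc.aemeasurable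
    (by fun_prop), ← hA t, ← ProbabilityTheory.charFun_stdGaussian, charFun_apply]
  simp only [LinearMap.adjoint_inner_right]

lemma map_gauss_add {s t : ℝ} (hs : 0 ≤ s) (ht : 0 ≤ t) :
    ((gauss G).prod (gauss G)).map (fun p => √s • p.1 + √t • p.2) =
      (gauss G).map (fun z => √(s + t) • z) := by
  have m (r : ℝ) : Measurable fun z : G => r • z := by fun_prop
  have e : ((gauss G).prod (gauss G)).map (fun p => √s • p.1 + √t • p.2) =
      (((gauss G).map (fun z => √s • z)).prod ((gauss G).map (fun z => √t • z))).map
        (fun p => p.1 + p.2) := by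
    rw [Measure.map_prod_map _ _ (m _) (m _), Measure.map_map (by fun_prop) (by fun_prop)]
    rfl
  have (r : ℝ) : IsProbabilityMeasure ((gauss G).map (fun z => r • z)) :=
    Measure.isProbabilityMeasure_map (m r).aemeasurable
  rw [e]
  have : IsProbabilityMeasure ((((gauss G).map (fun z => √s • z)).prod
    ((gauss G).map (fun z => √t • z))).map (fun p => p.1 + p.2)) :=
    Measure.isProbabilityMeasure_map (by fun_prop)
  refine Measure.ext_of_charFun ?_
  ext w
  rw [ProbabilityTheory.charFun_map_add_prod_eq_mul, Pi.mul_apply]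
  simp only [charFun_map_smul, ProbabilityTheory.charFun_stdGaussian]
  rw [← Complex.exp_add]
  congr 1
  simp only [norm_smul, Real.norm_eq_abs, abs_of_nonneg (Real.sqrt_nonneg _)]
  norm_cast
  rw [mul_pow, mul_pow, mul_pow, Real.sq_sqrt hs, Real.sq_sqrt ht, Real.sq_sqrt (by positivity)]
  ring

end Gaussian

end FRBL

namespace FRBL

lemma abs_exp_sub_one_sub_le (s : ℝ) : |Real.exp s - 1 - s| ≤ s ^ 2 * Real.exp |s| := by
  have h := Complex.norm_exp_sub_sum_le_norm_mul_exp (s : ℂ) 2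
  simp only [Finset.sum_range_succ, Finset.range_zero, Finset.sum_empty, zero_add, pow_zero,
    Nat.factorial, pow_one] at h
  rw [Complex.norm_real, Real.norm_eq_abs, sq_abs] at h
  have e : Complex.exp s - ((1 : ℂ) / ((1 : ℕ) : ℂ) + (s : ℂ) / (((0 + 1) * 1 : ℕ) : ℂ)) =
      ((Real.exp s - 1 - s : ℝ) : ℂ) := by push_cast; ring
  rw [e, Complex.norm_real, Real.norm_eq_abs] at h
  exact h

section Regular

variable {G : Type*} [NormedAddCommGroup G] [InnerProductSpace ℝ G] [FiniteDimensional ℝ G]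
  [MeasurableSpace G] [BorelSpace G]

/-- Positive functions with a quantitative first-order expansion, uniform relative to their
size. The class is stable under averaging of translates. -/
structure Reg (L M : ℝ) (f : G → ℝ) : Prop where
  meas : Measurable f
  pos : ∀ x, 0 < f x
  lip : ∀ x y, f (x + y) ≤ Real.exp (L * ‖y‖) * f x
  diff : ∃ D : G → G, Measurable D ∧ ∀ x, ‖D x‖ ≤ L * f x ∧
    ∀ y, |f (x + y) - f x - ⟪D x, y⟫| ≤ M * ‖y‖ ^ 2 * Real.exp (L * ‖y‖) * f x

variable {L M : ℝ} {f : G → ℝ} {Ω : Type*} [MeasurableSpace Ω] {P : Measure Ω}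

lemma Reg.integrable_comp (hf : Reg L M f) {Y : Ω → G} (hY : Measurable Y)
    (hi : ∀ C : ℝ, Integrable (fun ω => Real.exp (C * ‖Y ω‖)) P) (x : G) :
    Integrable (fun ω => f (x + Y ω)) P := by
  refine ((hi L).mul_const (f x)).mono' (hf.meas.comp (by fun_prop)).aestronglyMeasurable
    (Filter.Eventually.of_forall fun ω => ?_)
  rw [Real.norm_of_nonneg (hf.pos _).le]
  exact hf.lip _ _

lemma Reg.average (hf : Reg L M f) [IsProbabilityMeasure P] {Y : Ω → G} (hY : Measurable Y)
    (hi : ∀ C : ℝ, Integrable (fun ω => Real.exp (C * ‖Y ω‖)) P) :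
    Reg L M (fun x => ∫ ω, f (x + Y ω) ∂P) := by
  have hYint := hf.integrable_comp hY hi
  obtain ⟨D, hDm, hD⟩ := hf.diff
  have hDi (x : G) : Integrable (fun ω => D (x + Y ω)) P := by
    refine ((hYint x).const_mul L).mono' (hDm.comp (by fun_prop)).aestronglyMeasurable
      (Filter.Eventually.of_forall fun ω => (hD _).1)
  refine ⟨?_, fun x => ?_, fun x y => ?_, fun x => ∫ ω, D (x + Y ω) ∂P, ?_,
    fun x => ⟨?_, fun y => ?_⟩⟩
  · have h1 : Measurable fun p : G × Ω => p.1 + Y p.2 := by fun_prop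
    exact (StronglyMeasurable.integral_prod_right
      (f := fun x ω => f (x + Y ω)) (hf.meas.comp h1).stronglyMeasurable).measurable
  · refine (integral_pos_iff_support_of_nonneg (fun ω => (hf.pos _).le) (hYint x)).2 ?_
    have : (Function.support fun ω => f (x + Y ω)) = Set.univ := by
      ext ω; simp [(hf.pos (x + Y ω)).ne']
    rw [this]; simp
  · rw [← integral_const_mul]
    refine integral_mono (hYint _) ((hYint x).const_mul _) fun ω => ?_
    have := hf.lip (x + Y ω) y
    simpa [add_right_comm] using this
  · have h1 : Measurable fun p : G × Ω => p.1 + Y p.2 := by fun_prop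
    exact (StronglyMeasurable.integral_prod_right
      (f := fun x ω => D (x + Y ω)) (hDm.comp h1).stronglyMeasurable).measurable
  · refine (norm_integral_le_integral_norm _).trans ?_
    rw [← integral_const_mul]
    exact integral_mono (hDi x).norm ((hYint x).const_mul _) fun ω => (hD _).1
  · have e1 : ⟪∫ ω, D (x + Y ω) ∂P, y⟫ = ∫ ω, ⟪D (x + Y ω), y⟫ ∂P := by
      rw [real_inner_comm, ← integral_inner (hDi x)]
      simp only [real_inner_comm]
    have hin : Integrable (fun ω => ⟪D (x + Y ω), y⟫) P := (hDi x).inner_const y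
    have hi1 : Integrable (fun ω => f (x + y + Y ω) - f (x + Y ω)) P := (hYint _).sub (hYint _)
    rw [e1, ← integral_sub (hYint (x + y)) (hYint x), ← integral_sub hi1 hin, ← integral_const_mul]
    refine abs_integral_le_integral_abs.trans ?_
    refine integral_mono (hi1.sub hin).abs ((hYint x).const_mul _)
      fun ω => ?_
    have := (hD (x + Y ω)).2 y
    simpa [add_right_comm] using this

lemma Reg.abs_log_sub_le (hf : Reg L M f) (x y : G) :
    |Real.log (f (x + y)) - Real.log (f x)| ≤ L * ‖y‖ := by
  have h1 := Real.log_le_log (hf.pos _) (hf.lip x y)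
  have h2 := Real.log_le_log (hf.pos _) (hf.lip (x + y) (-y))
  rw [Real.log_mul (Real.exp_pos _).ne' (hf.pos _).ne', Real.log_exp] at h1 h2
  rw [add_neg_cancel_right, norm_neg] at h2
  rw [abs_le]
  constructor <;> linarith

lemma Reg.integrable_log_comp (hf : Reg L M f) [IsProbabilityMeasure P] {Y : Ω → G}
    (hY : Measurable Y) (hi : Integrable (fun ω => ‖Y ω‖) P) (x : G) :
    Integrable (fun ω => Real.log (f (x + Y ω))) P := by
  refine ((hi.const_mul L).add (integrable_const |Real.log (f x)|)).mono'
    (hf.meas.comp (by fun_prop)).log.aestronglyMeasurable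
    (Filter.Eventually.of_forall fun ω => ?_)
  have h := abs_sub_abs_le_abs_sub (Real.log (f (x + Y ω))) (Real.log (f x))
  have := hf.abs_log_sub_le x (Y ω)
  simp only [Real.norm_eq_abs, Pi.add_apply]
  linarith

lemma Reg.exists_log_expansion (hf : Reg L M f) (x : G) :
    ∃ θ : G, ‖θ‖ ≤ L ∧ ∀ y, |Real.log (f (x + y)) - Real.log (f x) - ⟪θ, y⟫| ≤
      (M + L ^ 2) * ‖y‖ ^ 2 * Real.exp (L * ‖y‖) := by
  obtain ⟨D, -, hD⟩ := hf.diff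
  have hp := hf.pos x
  refine ⟨(f x)⁻¹ • D x, ?_, fun y => ?_⟩
  · rw [norm_smul, norm_inv, Real.norm_of_nonneg hp.le, inv_mul_le_iff₀ hp, mul_comm]
    exact (hD x).1
  set s := Real.log (f (x + y)) - Real.log (f x) with hs
  have hes : Real.exp s = f (x + y) / f x := by
    rw [hs, Real.exp_sub, Real.exp_log (hf.pos _), Real.exp_log hp]
  have habs := hf.abs_log_sub_le x y
  rw [← hs] at habs
  have h1 := abs_exp_sub_one_sub_le s
  have h2 : |Real.exp s - 1 - ⟪(f x)⁻¹ • D x, y⟫| ≤ M * ‖y‖ ^ 2 * Real.exp (L * ‖y‖) := by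
    have := (hD x).2 y
    have e : Real.exp s - 1 - ⟪(f x)⁻¹ • D x, y⟫ =
        (f (x + y) - f x - ⟪D x, y⟫) / f x := by
      rw [hes, real_inner_smul_left]; field_simp
    rw [e, abs_div, abs_of_pos hp, div_le_iff₀ hp]
    exact this
  have h3 : s ^ 2 * Real.exp |s| ≤ L ^ 2 * ‖y‖ ^ 2 * Real.exp (L * ‖y‖) := by
    have : s ^ 2 ≤ (L * ‖y‖) ^ 2 := by
      rw [← sq_abs s]; gcongr
    rw [mul_pow] at this
    gcongr
  have h4 : |s - ⟪(f x)⁻¹ • D x, y⟫| ≤ |Real.exp s - 1 - s| +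
      |Real.exp s - 1 - ⟪(f x)⁻¹ • D x, y⟫| := by
    rw [← abs_neg (Real.exp s - 1 - s)]
    refine le_trans (le_of_eq ?_) (abs_add_le _ _)
    congr 1; ring
  nlinarith [h1, h2, h3, h4]

/-- The heat semigroup. -/
def heat (t : ℝ) (f : G → ℝ) (x : G) : ℝ := ∫ z, f (x + √t • z) ∂(gauss G)

lemma integrable_exp_norm_smul_gauss (r C : ℝ) :
    Integrable (fun z : G => Real.exp (C * ‖r • z‖)) (gauss G) := by
  simpa only [norm_smul, ← mul_assoc] using integrable_exp_norm_gauss (G := G) (C * ‖r‖)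

lemma integrable_norm_gauss : Integrable (fun z : G => ‖z‖) (gauss G) :=
  ProbabilityTheory.IsGaussian.integrable_id.norm

lemma Reg.heat (hf : Reg L M f) (t : ℝ) : Reg L M (heat t f) :=
  hf.average (by fun_prop) (integrable_exp_norm_smul_gauss _)

lemma integral_inner_gauss (θ : G) : ∫ z, ⟪θ, z⟫ ∂(gauss G) = 0 :=
  ProbabilityTheory.integral_strongDual_stdGaussian (innerSL ℝ θ)

lemma Reg.abs_remainder_le (hL : 0 ≤ L) (hM : 0 ≤ M) (hf : Reg L M f) (x : G) :
    ∃ θ : G, ‖θ‖ ≤ L ∧ ∀ h, 0 ≤ h → h ≤ 1 → ∀ z : G,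
      |Real.log (f (x + (h • θ + √h • z))) - Real.log (f x) - ⟪θ, h • θ + √h • z⟫| ≤
        h * (2 * (M + L ^ 2) * Real.exp ((L + 1) * (L + ‖z‖))) ∧
      |Real.log (f (x + (h • θ + √h • z))) - Real.log (f x) - ⟪θ, h • θ + √h • z⟫| ≤
        2 * L * (L + ‖z‖) := by
  obtain ⟨θ, hθ, hR⟩ := hf.exists_log_expansion x
  refine ⟨θ, hθ, fun h h0 h1 z => ?_⟩
  set y := h • θ + √h • z with hy
  have hsq : h ≤ √h := Real.le_sqrt_of_sq_le (by nlinarith)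
  have hs1 : √h ≤ 1 := Real.sqrt_le_iff.2 ⟨by norm_num, by simpa using h1⟩
  have hs0 := Real.sqrt_nonneg h
  have hLz : 0 ≤ L + ‖z‖ := by positivity
  have hn : ‖y‖ ≤ √h * (L + ‖z‖) := by
    refine (norm_add_le _ _).trans ?_
    rw [norm_smul, norm_smul, Real.norm_of_nonneg h0, Real.norm_of_nonneg hs0, mul_add]
    gcongr
  have hn1 : ‖y‖ ≤ L + ‖z‖ := hn.trans (mul_le_of_le_one_left hLz hs1)
  have hn2 : ‖y‖ ^ 2 ≤ h * (2 * Real.exp (L + ‖z‖)) := by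
    have h3 : ‖y‖ ^ 2 ≤ (√h * (L + ‖z‖)) ^ 2 := by gcongr
    rw [mul_pow, Real.sq_sqrt h0] at h3
    have h4 := Real.quadratic_le_exp_of_nonneg hLz
    refine h3.trans ?_
    gcongr
    nlinarith
  constructor
  · refine (hR y).trans ?_
    calc (M + L ^ 2) * ‖y‖ ^ 2 * Real.exp (L * ‖y‖)
        ≤ (M + L ^ 2) * (h * (2 * Real.exp (L + ‖z‖))) * Real.exp (L * (L + ‖z‖)) := by
          gcongr
      _ = _ := by
          have e : Real.exp ((L + 1) * (L + ‖z‖)) =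
              Real.exp (L + ‖z‖) * Real.exp (L * (L + ‖z‖)) := by
            rw [← Real.exp_add]; congr 1; ring
          rw [e]; ring
  · have h1 := hf.abs_log_sub_le x y
    have h2 : |⟪θ, y⟫| ≤ L * ‖y‖ := (abs_real_inner_le_norm _ _).trans (by gcongr)
    refine (abs_sub _ _).trans ?_
    nlinarith

/-- Infinitesimal form of the Borell–Föllmer variational formula, for regular functions. -/
lemma Reg.exists_log_heat_le (hL : 0 ≤ L) (hM : 0 ≤ M) :
    ∃ C : ℝ, 0 ≤ C ∧ ∀ f : G → ℝ, Reg L M f → ∀ h, 0 ≤ h → h ≤ 1 → ∀ x, ∃ θ : G,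
      Real.log (FRBL.heat h f x) ≤
        ∫ z, Real.log (f (x + (h • θ + √h • z))) ∂(gauss G) - h * ‖θ‖ ^ 2 / 2 + C * h ^ 2 := by
  set Ψ : G → ℝ := fun z => (2 * (M + L ^ 2) * Real.exp ((L + 1) * (L + ‖z‖))) ^ 2 *
    Real.exp (2 * L * (L + ‖z‖)) with hΨ
  have hΨi : Integrable Ψ (gauss G) := by
    have e : Ψ = fun z => ((2 * (M + L ^ 2)) ^ 2 * Real.exp (2 * (L + 1) * L + 2 * L * L)) *
        Real.exp ((2 * (L + 1) + 2 * L) * ‖z‖) := by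
      ext z
      rw [hΨ]
      simp only
      rw [mul_pow, ← Real.exp_nat_mul, mul_assoc, mul_assoc ((2 * (M + L ^ 2)) ^ 2),
        ← Real.exp_add, ← Real.exp_add]
      congr 2; push_cast; ring
    rw [e]
    exact (integrable_exp_norm_gauss _).const_mul _
  refine ⟨∫ z, Ψ z ∂(gauss G), integral_nonneg fun z => by positivity, ?_⟩
  intro f hf h h0 h1 x
  obtain ⟨θ, hθ, hR⟩ := hf.abs_remainder_le hL hM x
  refine ⟨θ, ?_⟩
  set R : G → ℝ := fun z =>
    Real.log (f (x + (h • θ + √h • z))) - Real.log (f x) - ⟪θ, h • θ + √h • z⟫ with hRdef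
  have hlogi : Integrable (fun z => Real.log (f (x + (h • θ + √h • z)))) (gauss G) := by
    refine hf.integrable_log_comp (by fun_prop) ?_ x
    refine ((integrable_const ‖h • θ‖).add ((integrable_norm_gauss (G := G)).const_mul ‖√h‖)).mono'
      (by fun_prop) (Filter.Eventually.of_forall fun z => ?_)
    rw [norm_norm]
    exact (norm_add_le _ _).trans (by simp [norm_smul])
  have hini : Integrable (fun z : G => ⟪θ, h • θ + √h • z⟫) (gauss G) := by
    have : Integrable (fun z : G => h • θ + √h • z) (gauss G) :=
      (integrable_const _).add (ProbabilityTheory.IsGaussian.integrable_id.smul (√h))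
    exact this.const_inner θ
  have hin : ∫ z, ⟪θ, h • θ + √h • z⟫ ∂(gauss G) = h * ‖θ‖ ^ 2 := by
    have hz : Integrable (fun z : G => ⟪θ, z⟫) (gauss G) :=
      (ProbabilityTheory.IsGaussian.integrable_id (μ := gauss G)).const_inner θ
    have e : (fun z : G => ⟪θ, h • θ + √h • z⟫) = fun z => h * ‖θ‖ ^ 2 + √h * ⟪θ, z⟫ := by
      ext z
      rw [inner_add_right, real_inner_smul_right, real_inner_smul_right,
        real_inner_self_eq_norm_sq]
    rw [e, integral_add (integrable_const _) (hz.const_mul _), integral_const_mul,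
      integral_const_mul, integral_inner_gauss]
    simp
  have hsi : Integrable (fun z => Real.log (f (x + (h • θ + √h • z))) - Real.log (f x))
      (gauss G) := hlogi.sub (integrable_const _)
  have hRi : Integrable R (gauss G) := hsi.sub hini
  have hRint : ∫ z, R z ∂(gauss G) =
      ∫ z, Real.log (f (x + (h • θ + √h • z))) ∂(gauss G) - Real.log (f x) - h * ‖θ‖ ^ 2 := by
    rw [hRdef, integral_sub hsi hini,
      integral_sub hlogi (integrable_const _), hin]
    simp
  have hpt (z : G) : Real.exp (R z) ≤ 1 + R z + h ^ 2 * Ψ z := by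
    have h2 := (abs_le.1 (abs_exp_sub_one_sub_le (R z))).2
    have h3 : R z ^ 2 * Real.exp |R z| ≤ h ^ 2 * Ψ z := by
      obtain ⟨ha, hb⟩ := hR h h0 h1 z
      have : R z ^ 2 ≤ (h * (2 * (M + L ^ 2) * Real.exp ((L + 1) * (L + ‖z‖)))) ^ 2 := by
        rw [← sq_abs (R z)]; gcongr
      rw [hΨ]
      simp only
      rw [← mul_assoc, ← mul_pow]
      gcongr
    linarith
  have hbi : Integrable (fun z => 1 + R z + h ^ 2 * Ψ z) (gauss G) :=
    ((integrable_const _).add hRi).add (hΨi.const_mul _)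
  have hexpi : Integrable (fun z => Real.exp (R z)) (gauss G) := by
    refine hbi.mono' (Real.continuous_exp.comp_aestronglyMeasurable hRi.aestronglyMeasurable)
      (Filter.Eventually.of_forall fun z => ?_)
    rw [Real.norm_of_nonneg (Real.exp_pos _).le]
    exact hpt z
  have hI : ∫ z, Real.exp (R z) ∂(gauss G) ≤
      1 + (∫ z, R z ∂(gauss G) + h ^ 2 * ∫ z, Ψ z ∂(gauss G)) := by
    refine (integral_mono hexpi hbi hpt).trans (le_of_eq ?_)
    have h1R : Integrable (fun z => 1 + R z) (gauss G) := (integrable_const _).add hRi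
    rw [integral_add h1R (hΨi.const_mul _),
      integral_add (integrable_const _) hRi, integral_const_mul]
    simp [add_assoc]
  have hIpos : 0 < ∫ z, Real.exp (R z) ∂(gauss G) := integral_exp_pos hexpi
  have hheat : FRBL.heat h f x =
      f x * Real.exp (h * ‖θ‖ ^ 2 / 2) * ∫ z, Real.exp (R z) ∂(gauss G) := by
    rw [FRBL.heat, integral_gauss_shift _ (√h • θ), ← integral_const_mul]
    congr 1; ext z
    have e1 : x + √h • (z + √h • θ) = x + (h • θ + √h • z) := by
      rw [smul_add, smul_smul, Real.mul_self_sqrt h0, add_comm (√h • z)]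
    rw [e1, hRdef]
    simp only
    rw [Real.exp_sub, Real.exp_sub, Real.exp_sub, Real.exp_log (hf.pos _), Real.exp_log (hf.pos x),
      norm_smul, mul_pow, Real.norm_eq_abs, sq_abs, Real.sq_sqrt h0, inner_add_right,
      real_inner_smul_left, real_inner_smul_right, real_inner_smul_right,
      real_inner_self_eq_norm_sq, Real.exp_neg, Real.exp_add]
    have : Real.exp (h * ‖θ‖ ^ 2) = Real.exp (h * ‖θ‖ ^ 2 / 2) * Real.exp (h * ‖θ‖ ^ 2 / 2) := by
      rw [← Real.exp_add]; congr 1; ring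
    rw [this]
    have := (hf.pos x).ne'
    field_simp
  rw [hheat, Real.log_mul (by have := hf.pos x; positivity) hIpos.ne',
    Real.log_mul (hf.pos x).ne' (Real.exp_pos _).ne', Real.log_exp]
  have h5 : Real.log (∫ z, Real.exp (R z) ∂(gauss G)) ≤
      ∫ z, R z ∂(gauss G) + h ^ 2 * ∫ z, Ψ z ∂(gauss G) :=
    (Real.log_le_sub_one_of_pos hIpos).trans (by linarith)
  rw [hRint] at h5
  linarith

end Regular

end FRBL

namespace FRBL

lemma integral_log_le_log_integral {Ω : Type*} [MeasurableSpace Ω] {P : Measure Ω}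
    [IsProbabilityMeasure P] {X : Ω → ℝ} (hpos : ∀ ω, 0 < X ω) (hi : Integrable X P)
    (hl : Integrable (fun ω => Real.log (X ω)) P) :
    ∫ ω, Real.log (X ω) ∂P ≤ Real.log (∫ ω, X ω ∂P) := by
  have hI : 0 < ∫ ω, X ω ∂P := by
    refine (integral_pos_iff_support_of_nonneg (fun ω => (hpos ω).le) hi).2 ?_
    have : Function.support X = Set.univ := by
      ext ω; simp [(hpos ω).ne']
    rw [this]; simp
  set a := ∫ ω, X ω ∂P with ha
  have h (ω : Ω) : Real.log (X ω) ≤ a⁻¹ * X ω + (Real.log a - 1) := by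
    have := Real.log_le_sub_one_of_pos (div_pos (hpos ω) hI)
    rw [Real.log_div (hpos ω).ne' hI.ne', div_eq_inv_mul] at this
    linarith
  have hai : Integrable (fun ω => a⁻¹ * X ω) P := hi.const_mul _
  refine (integral_mono hl (hai.add (integrable_const _)) h).trans (le_of_eq ?_)
  rw [integral_add' hai (integrable_const _), integral_const_mul, ← ha, inv_mul_cancel₀ hI.ne']
  simp

section Bounded

variable {G : Type*} [NormedAddCommGroup G] [InnerProductSpace ℝ G] [FiniteDimensional ℝ G]
  [MeasurableSpace G] [BorelSpace G]

/-- Bounded measurable functions with an exponential lower bound. -/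
structure ExpBdd (g : G → ℝ) : Prop where
  meas : Measurable g
  bdd : ∃ M, ∀ y, g y ≤ M
  lower : ∃ a C, 0 < a ∧ 0 ≤ C ∧ ∀ y, a * Real.exp (-(C * ‖y‖)) ≤ g y

variable {g : G → ℝ} {Ω : Type*} [MeasurableSpace Ω] {P : Measure Ω}

lemma ExpBdd.pos (hg : ExpBdd g) (y : G) : 0 < g y := by
  obtain ⟨a, C, ha, -, h⟩ := hg.lower
  exact lt_of_lt_of_le (by positivity) (h y)

lemma ExpBdd.integrable_comp (hg : ExpBdd g) [IsFiniteMeasure P] {Y : Ω → G} (hY : Measurable Y)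
    (y : G) : Integrable (fun ω => g (y + Y ω)) P := by
  obtain ⟨M, hM⟩ := hg.bdd
  refine (integrable_const M).mono' (hg.meas.comp (by fun_prop)).aestronglyMeasurable
    (Filter.Eventually.of_forall fun ω => ?_)
  rw [Real.norm_of_nonneg (hg.pos _).le]
  exact hM _

lemma ExpBdd.average (hg : ExpBdd g) [IsProbabilityMeasure P] {Y : Ω → G} (hY : Measurable Y) :
    ExpBdd (fun y => ∫ ω, g (y + Y ω) ∂P) := by
  have hYint := hg.integrable_comp (P := P) hY
  obtain ⟨M, hM⟩ := hg.bdd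
  obtain ⟨a, C, ha, hC, hl⟩ := hg.lower
  have hei : Integrable (fun ω => Real.exp (-(C * ‖Y ω‖))) P := by
    refine (integrable_const 1).mono' (by fun_prop) (Filter.Eventually.of_forall fun ω => ?_)
    rw [Real.norm_of_nonneg (Real.exp_pos _).le]
    exact Real.exp_le_one_iff.2 (by have := norm_nonneg (Y ω); nlinarith)
  refine ⟨?_, ⟨M, fun y => ?_⟩,
    ⟨a * ∫ ω, Real.exp (-(C * ‖Y ω‖)) ∂P, C, mul_pos ha (integral_exp_pos hei), hC, fun y => ?_⟩⟩
  · have h1 : Measurable fun p : G × Ω => p.1 + Y p.2 := by fun_prop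
    exact (StronglyMeasurable.integral_prod_right
      (f := fun x ω => g (x + Y ω)) (hg.meas.comp h1).stronglyMeasurable).measurable
  · refine (integral_mono (hYint y) (integrable_const M) fun ω => hM _).trans ?_
    simp
  · rw [mul_right_comm, ← integral_const_mul]
    refine integral_mono (hei.const_mul _) (hYint y) fun ω => le_trans ?_ (hl _)
    rw [mul_assoc, ← Real.exp_add]
    gcongr
    have := norm_add_le y (Y ω)
    nlinarith

lemma ExpBdd.exists_abs_log_le (hg : ExpBdd g) :
    ∃ K C, 0 ≤ K ∧ 0 ≤ C ∧ ∀ y, |Real.log (g y)| ≤ K + C * ‖y‖ := by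
  obtain ⟨M, hM⟩ := hg.bdd
  obtain ⟨a, C, ha, hC, hl⟩ := hg.lower
  refine ⟨|Real.log M| + |Real.log a|, C, by positivity, hC, fun y => ?_⟩
  have h1 := Real.log_le_log (hg.pos y) (hM y)
  have h2 := Real.log_le_log (by positivity) (hl y)
  rw [Real.log_mul ha.ne' (Real.exp_pos _).ne', Real.log_exp] at h2
  have := mul_nonneg hC (norm_nonneg y)
  rw [abs_le]
  constructor
  · linarith [neg_abs_le (Real.log a), abs_nonneg (Real.log M)]
  · linarith [le_abs_self (Real.log M), abs_nonneg (Real.log a)]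

lemma ExpBdd.integrable_log_comp (hg : ExpBdd g) [IsFiniteMeasure P] {Y : Ω → G}
    (hY : Measurable Y) (hi : Integrable (fun ω => ‖Y ω‖) P) (y : G) :
    Integrable (fun ω => Real.log (g (y + Y ω))) P := by
  obtain ⟨K, C, hK, hC, h⟩ := hg.exists_abs_log_le
  refine ((hi.const_mul C).add (integrable_const (K + C * ‖y‖))).mono'
    (hg.meas.comp (by fun_prop)).log.aestronglyMeasurable
    (Filter.Eventually.of_forall fun ω => (h _).trans ?_)
  simp only [Pi.add_apply]
  have := norm_add_le y (Y ω)
  nlinarith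

lemma ExpBdd.heat (hg : ExpBdd g) (t : ℝ) : ExpBdd (heat t g) := hg.average (by fun_prop)

lemma integrable_norm_add_smul_gauss (a : G) (r : ℝ) :
    Integrable (fun z : G => ‖a + r • z‖) (gauss G) := by
  refine ((integrable_const ‖a‖).add ((integrable_norm_gauss (G := G)).const_mul ‖r‖)).mono'
    (by fun_prop) (Filter.Eventually.of_forall fun z => ?_)
  rw [norm_norm]
  exact (norm_add_le _ _).trans (by simp [norm_smul])

lemma ExpBdd.le_log_heat (hg : ExpBdd g) {h : ℝ} (h0 : 0 ≤ h) (y φ : G) :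
    ∫ z, Real.log (g (y + (h • φ + √h • z))) ∂(gauss G) - h * ‖φ‖ ^ 2 / 2 ≤
      Real.log (FRBL.heat h g y) := by
  have hli := hg.integrable_log_comp (P := gauss G) (Y := fun z => h • φ + √h • z)
    (by fun_prop) (integrable_norm_add_smul_gauss _ _) y
  have hz : Integrable (fun z : G => ⟪φ, z⟫) (gauss G) :=
    (ProbabilityTheory.IsGaussian.integrable_id (μ := gauss G)).const_inner φ
  set X : G → ℝ := fun z => g (y + (h • φ + √h • z)) *
    Real.exp (-(√h * ⟪φ, z⟫) - h * ‖φ‖ ^ 2 / 2) with hX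
  have hheat : FRBL.heat h g y = ∫ z, X z ∂(gauss G) := by
    rw [FRBL.heat, integral_gauss_shift _ (√h • φ)]
    congr 1; ext z
    rw [hX]
    simp only
    rw [smul_add, smul_smul, Real.mul_self_sqrt h0, add_comm (√h • z), real_inner_smul_left,
      norm_smul, mul_pow, Real.norm_eq_abs, sq_abs, Real.sq_sqrt h0]
  have hXpos (z : G) : 0 < X z := mul_pos (hg.pos _) (Real.exp_pos _)
  have hlogX (z : G) : Real.log (X z) = Real.log (g (y + (h • φ + √h • z))) +
      (-√h * ⟪φ, z⟫ + (- h * ‖φ‖ ^ 2 / 2)) := by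
    rw [hX]
    simp only
    rw [Real.log_mul (hg.pos _).ne' (Real.exp_pos _).ne', Real.log_exp]
    ring
  have hXi : Integrable X (gauss G) := by
    obtain ⟨M, hM⟩ := hg.bdd
    have hM0 : 0 ≤ M := (hg.pos 0).le.trans (hM 0)
    refine ((integrable_exp_norm_gauss (G := G) (√h * ‖φ‖)).const_mul M).mono'
      ((hg.meas.comp (by fun_prop)).mul (by fun_prop)).aestronglyMeasurable
      (Filter.Eventually.of_forall fun z => ?_)
    rw [Real.norm_of_nonneg (hXpos z).le, hX]
    simp only
    have h1 : -(√h * ⟪φ, z⟫) - h * ‖φ‖ ^ 2 / 2 ≤ √h * ‖φ‖ * ‖z‖ := by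
      have h2 := neg_le_of_abs_le (abs_real_inner_le_norm φ z)
      have h3 := mul_le_mul_of_nonneg_left h2 (Real.sqrt_nonneg h)
      have h4 : 0 ≤ h * ‖φ‖ ^ 2 / 2 := by positivity
      linarith
    exact mul_le_mul (hM _) (Real.exp_le_exp.2 h1) (Real.exp_pos _).le hM0
  have hlin : Integrable (fun z : G => -√h * ⟪φ, z⟫) (gauss G) := hz.const_mul _
  have hlin' : Integrable (fun z : G => -√h * ⟪φ, z⟫ + (- h * ‖φ‖ ^ 2 / 2)) (gauss G) :=
    hlin.add (integrable_const _)
  rw [hheat]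
  refine le_trans (le_of_eq ?_) (integral_log_le_log_integral hXpos hXi ?_)
  · simp only [hlogX]
    rw [integral_add hli hlin', integral_add hlin (integrable_const _), integral_const_mul,
      integral_inner_gauss]
    simp; ring
  · simp only [hlogX]
    exact hli.add hlin'

lemma heat_zero (f : G → ℝ) : heat 0 f = f := by
  ext x; simp [heat]

lemma heat_heat {f : G → ℝ} (hm : Measurable f)
    (hi : ∀ (r : ℝ) (x : G), Integrable (fun z => f (x + r • z)) (gauss G)) {s t : ℝ}
    (hs : 0 ≤ s) (ht : 0 ≤ t) : heat s (heat t f) = heat (s + t) f := by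
  ext x
  have hmap := map_gauss_add (G := G) hs ht
  have hfm : Measurable fun w => f (x + w) := hm.comp (by fun_prop)
  have e1 : heat (s + t) f x = ∫ p, f (x + (√s • p.1 + √t • p.2)) ∂((gauss G).prod (gauss G)) := by
    have h1 : ∫ w, f (x + w) ∂((gauss G).map fun z => √(s + t) • z) = heat (s + t) f x :=
      integral_map (by fun_prop) hfm.aestronglyMeasurable
    rw [← h1, ← hmap, integral_map (by fun_prop) hfm.aestronglyMeasurable]
  have hYint : Integrable (fun p : G × G => f (x + (√s • p.1 + √t • p.2)))
      ((gauss G).prod (gauss G)) := by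
    have h1 : Integrable (fun w => f (x + w)) ((gauss G).map fun z => √(s + t) • z) :=
      (integrable_map_measure hfm.aestronglyMeasurable (by fun_prop)).2 (hi _ _)
    rw [← hmap] at h1
    exact (integrable_map_measure hfm.aestronglyMeasurable (by fun_prop)).1 h1
  rw [e1, integral_prod _ hYint]
  simp only [heat, add_assoc]

lemma Reg.heat_heat {L M : ℝ} {f : G → ℝ} (hf : Reg L M f) {s t : ℝ} (hs : 0 ≤ s) (ht : 0 ≤ t) :
    FRBL.heat s (FRBL.heat t f) = FRBL.heat (s + t) f :=
  FRBL.heat_heat hf.meas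
    (fun r x => hf.integrable_comp (by fun_prop) (integrable_exp_norm_smul_gauss r) x) hs ht

lemma ExpBdd.heat_heat (hg : ExpBdd g) {s t : ℝ} (hs : 0 ≤ s) (ht : 0 ≤ t) :
    FRBL.heat s (FRBL.heat t g) = FRBL.heat (s + t) g :=
  FRBL.heat_heat hg.meas (fun r x => hg.integrable_comp (by fun_prop) x) hs ht

end Bounded

section Flow

variable {k m : ℕ}
  {E : Fin k → Type*} {F : Fin m → Type*}
  [∀ i, NormedAddCommGroup (E i)] [∀ i, InnerProductSpace ℝ (E i)]
  [∀ i, FiniteDimensional ℝ (E i)]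
  [∀ i, MeasurableSpace (E i)] [∀ i, BorelSpace (E i)]
  [∀ j, NormedAddCommGroup (F j)] [∀ j, InnerProductSpace ℝ (F j)]
  [∀ j, FiniteDimensional ℝ (F j)]
  [∀ j, MeasurableSpace (F j)] [∀ j, BorelSpace (F j)]
  {c : Fin k → ℝ} {d : Fin m → ℝ} {B : ∀ i j, E i →ₗ[ℝ] F j}

variable (E F c B) in
/-- A coupling of standard gaussians on the spaces `E i` (as linear images of a standard
gaussian) whose images in the spaces `F j` are again standard. -/
def GaussCoupling {H : Type*} [NormedAddCommGroup H] [InnerProductSpace ℝ H]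
    [FiniteDimensional ℝ H] (A : ∀ i, H →ₗ[ℝ] E i) : Prop :=
  (∀ i t, ‖adjoint (A i) t‖ = ‖t‖) ∧
    ∀ j t, ‖adjoint (∑ i, c i • B i j ∘ₗ A i) t‖ = ‖t‖

variable {H : Type*} [NormedAddCommGroup H] [InnerProductSpace ℝ H] [FiniteDimensional ℝ H]
  {A : ∀ i, H →ₗ[ℝ] E i}

lemma GaussCoupling.log_heat_step [MeasurableSpace H] [BorelSpace H]
    (hA : GaussCoupling E F c B A) (hc : ∀ i, 0 < c i) (hd : ∀ j, 0 < d j)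
    (hG : ∀ x : ∀ i, E i, ∑ j, d j * ‖∑ i, c i • B i j (x i)‖ ^ 2 ≤ ∑ i, c i * ‖x i‖ ^ 2)
    {L M : ℝ} (hL : 0 ≤ L) (hM : 0 ≤ M) :
    ∃ C, ∀ (f : ∀ i, E i → ℝ) (g : ∀ j, F j → ℝ) (K : ℝ),
      (∀ i, Reg L M (f i)) → (∀ j, ExpBdd (g j)) →
      (∀ x : ∀ i, E i, ∑ i, c i * Real.log (f i (x i)) ≤
        ∑ j, d j * Real.log (g j (∑ i, c i • B i j (x i))) + K) →
      ∀ h, 0 ≤ h → h ≤ 1 → ∀ x : ∀ i, E i, ∑ i, c i * Real.log (heat h (f i) (x i)) ≤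
        ∑ j, d j * Real.log (heat h (g j) (∑ i, c i • B i j (x i))) + (K + C * h ^ 2) := by
  have hC (i) := Reg.exists_log_heat_le (G := E i) hL hM
  choose C hC0 hC using hC
  refine ⟨∑ i, c i * C i, fun f g K hf hg hfg h h0 h1 x => ?_⟩
  have hθ (i) := hC i (f i) (hf i) h h0 h1 (x i)
  choose θ hθ using hθ
  set A' : ∀ j, H →ₗ[ℝ] F j := fun j => ∑ i, c i • B i j ∘ₗ A i with hA'
  have hAc (i) : Measurable (A i) := (A i).continuous_of_finiteDimensional.measurable
  have hAc' (j) : Measurable (A' j) := (A' j).continuous_of_finiteDimensional.measurable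
  set y : ∀ j, F j := fun j => ∑ i, c i • B i j (x i) with hy
  set φ : ∀ j, F j := fun j => ∑ i, c i • B i j (θ i) with hφ
  have hφy (j) (ξ : H) : ∑ i, c i • B i j (x i + (h • θ i + √h • A i ξ)) =
      y j + (h • φ j + √h • A' j ξ) := by
    simp only [map_add, map_smul, smul_add, Finset.sum_add_distrib, hy, hφ, hA',
      LinearMap.sum_apply, LinearMap.smul_apply, LinearMap.comp_apply, Finset.smul_sum]
    simp only [smul_comm h, smul_comm √h]
  have hfm (i) : Measurable fun z => Real.log (f i (x i + (h • θ i + √h • z))) :=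
    ((hf i).meas.comp (by fun_prop)).log
  have hgm (j) : Measurable fun z => Real.log (g j (y j + (h • φ j + √h • z))) :=
    ((hg j).meas.comp (by fun_prop)).log
  have hfi (i) : Integrable (fun ξ => Real.log (f i (x i + (h • θ i + √h • A i ξ))))
      (gauss H) := by
    have h1 := (hf i).integrable_log_comp (P := gauss (E i)) (Y := fun z => h • θ i + √h • z)
      (by fun_prop) (integrable_norm_add_smul_gauss _ _) (x i)
    rw [← map_gauss_of_adjoint (A i) (hA.1 i)] at h1
    exact (integrable_map_measure (hfm i).aestronglyMeasurable (hAc i).aemeasurable).1 h1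
  have hgi (j) : Integrable (fun ξ => Real.log (g j (y j + (h • φ j + √h • A' j ξ))))
      (gauss H) := by
    have h1 := (hg j).integrable_log_comp (P := gauss (F j)) (Y := fun z => h • φ j + √h • z)
      (by fun_prop) (integrable_norm_add_smul_gauss _ _) (y j)
    rw [← map_gauss_of_adjoint (A' j) (hA.2 j)] at h1
    exact (integrable_map_measure (hgm j).aestronglyMeasurable (hAc' j).aemeasurable).1 h1
  have hfint (i) : ∫ z, Real.log (f i (x i + (h • θ i + √h • z))) ∂(gauss (E i)) =
      ∫ ξ, Real.log (f i (x i + (h • θ i + √h • A i ξ))) ∂(gauss H) := by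
    rw [← map_gauss_of_adjoint (A i) (hA.1 i),
      integral_map (hAc i).aemeasurable (hfm i).aestronglyMeasurable]
  have hgint (j) : ∫ z, Real.log (g j (y j + (h • φ j + √h • z))) ∂(gauss (F j)) =
      ∫ ξ, Real.log (g j (y j + (h • φ j + √h • A' j ξ))) ∂(gauss H) := by
    rw [← map_gauss_of_adjoint (A' j) (hA.2 j),
      integral_map (hAc' j).aemeasurable (hgm j).aestronglyMeasurable]
  have hmain : ∑ i, c i * ∫ ξ, Real.log (f i (x i + (h • θ i + √h • A i ξ))) ∂(gauss H) ≤
      ∑ j, d j * ∫ ξ, Real.log (g j (y j + (h • φ j + √h • A' j ξ))) ∂(gauss H) + K := by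
    have hKc : ∫ _, K ∂(gauss H) = K := by simp
    have hsg : Integrable (fun ξ => ∑ j, d j * Real.log (g j (y j + (h • φ j + √h • A' j ξ))))
        (gauss H) := integrable_finsetSum _ fun j _ => (hgi j).const_mul _
    simp only [← integral_const_mul]
    rw [← integral_finsetSum _ fun i _ => (hfi i).const_mul _,
      ← integral_finsetSum _ fun j _ => (hgi j).const_mul _]
    nth_rewrite 1 [← hKc]
    rw [← integral_add hsg (integrable_const _)]
    refine integral_mono (integrable_finsetSum _ fun i _ => (hfi i).const_mul _)
      (hsg.add (integrable_const _)) fun ξ => ?_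
    have := hfg fun i => x i + (h • θ i + √h • A i ξ)
    simp only [hφy] at this
    exact this
  have hF : ∑ i, c i * Real.log (heat h (f i) (x i)) ≤
      ∑ i, c i * ∫ ξ, Real.log (f i (x i + (h • θ i + √h • A i ξ))) ∂(gauss H) -
        h / 2 * ∑ i, c i * ‖θ i‖ ^ 2 + (∑ i, c i * C i) * h ^ 2 := by
    rw [Finset.mul_sum, Finset.sum_mul, ← Finset.sum_sub_distrib, ← Finset.sum_add_distrib]
    refine Finset.sum_le_sum fun i _ => ?_
    have := mul_le_mul_of_nonneg_left (hθ i) (hc i).le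
    rw [hfint] at this
    linarith
  have hGG : ∑ j, d j * ∫ ξ, Real.log (g j (y j + (h • φ j + √h • A' j ξ))) ∂(gauss H) -
        h / 2 * ∑ j, d j * ‖φ j‖ ^ 2 ≤ ∑ j, d j * Real.log (heat h (g j) (y j)) := by
    rw [Finset.mul_sum, ← Finset.sum_sub_distrib]
    refine Finset.sum_le_sum fun j _ => ?_
    have := mul_le_mul_of_nonneg_left ((hg j).le_log_heat h0 (y j) (φ j)) (hd j).le
    rw [hgint] at this
    linarith
  have hq := mul_le_mul_of_nonneg_left (hG θ) (show 0 ≤ h / 2 by positivity)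
  change _ ≤ ∑ j, d j * Real.log (heat h (g j) (y j)) + _
  change h / 2 * ∑ j, d j * ‖φ j‖ ^ 2 ≤ _ at hq
  linarith

lemma GaussCoupling.log_heat_le [MeasurableSpace H] [BorelSpace H]
    (hA : GaussCoupling E F c B A) (hc : ∀ i, 0 < c i) (hd : ∀ j, 0 < d j)
    (hG : ∀ x : ∀ i, E i, ∑ j, d j * ‖∑ i, c i • B i j (x i)‖ ^ 2 ≤ ∑ i, c i * ‖x i‖ ^ 2)
    {L M : ℝ} (hL : 0 ≤ L) (hM : 0 ≤ M) {f : ∀ i, E i → ℝ} {g : ∀ j, F j → ℝ}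
    (hf : ∀ i, Reg L M (f i)) (hg : ∀ j, ExpBdd (g j))
    (hfg : ∀ x : ∀ i, E i, ∑ i, c i * Real.log (f i (x i)) ≤
      ∑ j, d j * Real.log (g j (∑ i, c i • B i j (x i)))) {T : ℝ} (hT : 0 ≤ T) (x : ∀ i, E i) :
    ∑ i, c i * Real.log (heat T (f i) (x i)) ≤
      ∑ j, d j * Real.log (heat T (g j) (∑ i, c i • B i j (x i))) := by
  obtain ⟨C, hC⟩ := hA.log_heat_step hc hd hG hL hM
  have key (h : ℝ) (h0 : 0 ≤ h) (h1 : h ≤ 1) (n : ℕ) : ∀ x : ∀ i, E i,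
      ∑ i, c i * Real.log (heat (n * h) (f i) (x i)) ≤
        ∑ j, d j * Real.log (heat (n * h) (g j) (∑ i, c i • B i j (x i))) + n * (C * h ^ 2) := by
    induction n with
    | zero => simpa [heat_zero] using hfg
    | succ n ih =>
      intro x
      have hn : 0 ≤ n * h := by positivity
      have := hC _ _ _ (fun i => (hf i).heat (n * h)) (fun j => (hg j).heat (n * h)) ih h h0 h1 x
      have e : ((n + 1 : ℕ) : ℝ) * h = h + n * h := by push_cast; ring
      rw [e]
      simp only [(hf _).heat_heat h0 hn, (hg _).heat_heat h0 hn] at this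
      refine this.trans (le_of_eq ?_)
      push_cast; ring
  have hlim : Filter.Tendsto (fun n : ℕ => C * T ^ 2 / (n : ℝ)) Filter.atTop (nhds 0) :=
    tendsto_const_div_atTop_nhds_zero_nat _
  have hev : ∀ᶠ n : ℕ in Filter.atTop, ∑ i, c i * Real.log (heat T (f i) (x i)) ≤
      ∑ j, d j * Real.log (heat T (g j) (∑ i, c i • B i j (x i))) + C * T ^ 2 / (n : ℝ) := by
    filter_upwards [Filter.eventually_ge_atTop (⌈T⌉₊ + 1)] with n hn
    have hn0 : (0 : ℝ) < n := by
      have : 0 < n := by omega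
      exact_mod_cast this
    have hTn : T ≤ n := (Nat.le_ceil T).trans (by exact_mod_cast (by omega : ⌈T⌉₊ ≤ n))
    have := key (T / n) (by positivity) ((div_le_one hn0).2 hTn) n x
    rw [mul_div_cancel₀ _ hn0.ne'] at this
    refine this.trans (le_of_eq ?_)
    field_simp
  have := ge_of_tendsto (tendsto_const_nhds.add hlim) hev
  simpa using this

end Flow

end FRBL

namespace FRBL

lemma mul_rpow_le_of_forall_lt {b a R : ℝ≥0∞} {c : ℝ} (hc : 0 < c)
    (h : ∀ r < a, b * r ^ c ≤ R) : b * a ^ c ≤ R := by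
  rcases eq_or_ne a 0 with rfl | ha
  · simp [ENNReal.zero_rpow_of_pos hc]
  rcases eq_or_ne b 0 with rfl | hb
  · simp
  by_cases hbt : b = ∞
  · subst hbt
    obtain ⟨r, hr0, hr⟩ := exists_between (pos_iff_ne_zero.2 ha)
    have h1 : r ^ c ≠ 0 := by
      simp [ENNReal.rpow_eq_zero_iff, hr0.ne', hc, hc.not_gt]
    have := h r hr
    rw [ENNReal.top_mul h1, top_le_iff] at this
    simp [this]
  have h' : ∀ r < a, r ≤ (R / b) ^ c⁻¹ := fun r hr => by
    rw [ENNReal.le_rpow_inv_iff hc, ENNReal.le_div_iff_mul_le (Or.inl hb) (Or.inl hbt), mul_comm]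
    exact h r hr
  have := le_of_forall_lt_imp_le_of_dense h'
  rwa [ENNReal.le_rpow_inv_iff hc, ENNReal.le_div_iff_mul_le (Or.inl hb) (Or.inl hbt),
    mul_comm] at this

lemma prod_rpow_le_of_forall_lt {ι : Type*} [Fintype ι] {c : ι → ℝ} (hc : ∀ i, 0 < c i)
    {a : ι → ℝ≥0∞} {R : ℝ≥0∞}
    (h : ∀ r : ι → ℝ≥0∞, (∀ i, r i < a i) → ∏ i, r i ^ c i ≤ R) : ∏ i, a i ^ c i ≤ R := by
  classical
  have key (s : Finset ι) : ∀ r : ι → ℝ≥0∞, (∀ i ∈ s, r i = a i) → (∀ i ∉ s, r i < a i) →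
      ∏ i, r i ^ c i ≤ R := by
    induction s using Finset.induction_on with
    | empty => exact fun r _ h2 => h r fun i => h2 i (by simp)
    | insert i₀ s hi ih =>
      intro r h1 h2
      rw [← Finset.prod_erase_mul _ _ (Finset.mem_univ i₀), h1 i₀ (by simp)]
      refine mul_rpow_le_of_forall_lt (hc i₀) fun q hq => ?_
      have := ih (Function.update r i₀ q) (fun i his => ?_) (fun i his => ?_)
      · rw [← Finset.prod_erase_mul _ _ (Finset.mem_univ i₀), Function.update_self] at this
        refine le_of_eq_of_le ?_ this
        congr 1
        refine Finset.prod_congr rfl fun i hi' => ?_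
        rw [Function.update_of_ne (Finset.ne_of_mem_erase hi')]
      · have : i ≠ i₀ := by rintro rfl; exact hi his
        rw [Function.update_of_ne this]
        exact h1 i (by simp [his])
      · rcases eq_or_ne i i₀ with rfl | hne
        · simpa using hq
        · rw [Function.update_of_ne hne]
          exact h2 i (by simp [his, hne])
  exact key Finset.univ a (by simp) (by simp)

lemma prod_rpow_le_of_le_liminf {ι : Type*} [Fintype ι] {c : ι → ℝ} (hc : ∀ i, 0 < c i)
    {a : ι → ℝ≥0∞} {u : ι → ℕ → ℝ≥0∞} {R : ℝ≥0∞}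
    (ha : ∀ i, a i ≤ Filter.liminf (u i) Filter.atTop)
    (h : ∀ᶠ n in Filter.atTop, ∏ i, u i n ^ c i ≤ R) : ∏ i, a i ^ c i ≤ R := by
  refine prod_rpow_le_of_forall_lt hc fun r hr => ?_
  have h1 : ∀ᶠ n in Filter.atTop, ∀ i, r i < u i n := Filter.eventually_all.2 fun i =>
    Filter.eventually_lt_of_lt_liminf ((hr i).trans_le (ha i))
  obtain ⟨n, hn, hn'⟩ := (h.and h1).exists
  refine le_trans (Finset.prod_le_prod' fun i _ => ?_) hn
  exact ENNReal.rpow_le_rpow (hn' i).le (hc i).le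

lemma ofReal_exp_sum_mul_log {ι : Type*} [Fintype ι] (c : ι → ℝ) {r : ι → ℝ}
    (hr : ∀ i, 0 < r i) :
    ENNReal.ofReal (Real.exp (∑ i, c i * Real.log (r i))) =
      ∏ i, ENNReal.ofReal (r i) ^ c i := by
  rw [Real.exp_sum, ENNReal.ofReal_prod_of_nonneg fun i _ => (Real.exp_pos _).le]
  refine Finset.prod_congr rfl fun i _ => ?_
  rw [ENNReal.ofReal_rpow_of_pos (hr i), Real.rpow_def_of_pos (hr i), mul_comm]

section HeatZero

variable {G : Type*} [NormedAddCommGroup G] [InnerProductSpace ℝ G] [FiniteDimensional ℝ G]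
  [MeasurableSpace G] [BorelSpace G] {f : G → ℝ} {T : ℝ}

lemma heat_apply_zero (hT : 0 < T) (f : G → ℝ) :
    heat T f 0 = (2 * Real.pi * T) ^ (-(Module.finrank ℝ G : ℝ) / 2) *
      ∫ y, Real.exp (-‖y‖ ^ 2 / (2 * T)) * f y := by
  have hs : 0 < √T := Real.sqrt_pos.2 hT
  have h1 := Measure.integral_comp_smul (volume : Measure G)
    (fun y => Real.exp (-‖y‖ ^ 2 / (2 * T)) * f y) √T
  rw [heat, integral_gauss]
  have e (z : G) : ((2 * Real.pi) ^ (-(Module.finrank ℝ G : ℝ) / 2) * Real.exp (-‖z‖ ^ 2 / 2)) •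
      f (0 + √T • z) = (2 * Real.pi) ^ (-(Module.finrank ℝ G : ℝ) / 2) *
        (Real.exp (-‖√T • z‖ ^ 2 / (2 * T)) * f (√T • z)) := by
    rw [norm_smul, mul_pow, Real.norm_eq_abs, sq_abs, Real.sq_sqrt hT.le, zero_add, smul_eq_mul,
      mul_assoc, show -(T * ‖z‖ ^ 2) / (2 * T) = -‖z‖ ^ 2 / 2 by field_simp]
  simp only [e]
  rw [integral_const_mul, h1, smul_eq_mul, ← mul_assoc]
  congr 1
  rw [Real.mul_rpow (by positivity) hT.le, abs_of_pos (by positivity)]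
  congr 1
  rw [← Real.rpow_natCast, Real.sqrt_eq_rpow, ← Real.rpow_mul hT.le, ← Real.rpow_neg hT.le]
  congr 1; ring

lemma integral_exp_mul_pos_of_heat_pos (hT : 0 < T) (h : 0 < heat T f 0) :
    0 < ∫ y, Real.exp (-‖y‖ ^ 2 / (2 * T)) * f y := by
  rw [heat_apply_zero hT] at h
  exact (pos_iff_pos_of_mul_pos h).1 (by positivity)

lemma log_heat_apply_zero (hT : 0 < T) (h : 0 < heat T f 0) :
    Real.log (heat T f 0) = Real.log (∫ y, Real.exp (-‖y‖ ^ 2 / (2 * T)) * f y) -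
      Real.log (2 * Real.pi * T) / 2 * Module.finrank ℝ G := by
  have h1 := integral_exp_mul_pos_of_heat_pos hT h
  rw [heat_apply_zero hT, Real.log_mul (by positivity) h1.ne', Real.log_rpow (by positivity)]
  ring

lemma ofReal_integral_exp_mul_of_heat_pos (hT : 0 < T) (h : 0 < heat T f 0)
    (hf : ∀ y, 0 < f y) :
    ENNReal.ofReal (∫ y, Real.exp (-‖y‖ ^ 2 / (2 * T)) * f y) =
      ∫⁻ y, ENNReal.ofReal (Real.exp (-‖y‖ ^ 2 / (2 * T)) * f y) :=
  ofReal_integral_eq_lintegral_ofReal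
    (.of_integral_ne_zero (integral_exp_mul_pos_of_heat_pos hT h).ne')
    (Filter.Eventually.of_forall fun y => (mul_pos (Real.exp_pos _) (hf y)).le)

lemma lintegral_le_liminf_exp_mul (hf : Measurable f) :
    ∫⁻ y, ENNReal.ofReal (f y) ≤ Filter.liminf (fun n : ℕ =>
      ∫⁻ y, ENNReal.ofReal (Real.exp (-‖y‖ ^ 2 / (2 * (n + 1 : ℝ))) * f y)) Filter.atTop := by
  refine le_trans (le_of_eq (lintegral_congr fun y => ?_)) (lintegral_liminf_le fun n => ?_)
  · refine (Filter.Tendsto.liminf_eq ?_).symm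
    refine ENNReal.tendsto_ofReal ?_
    have h1 : Filter.Tendsto (fun n : ℕ => -‖y‖ ^ 2 / (2 * (n + 1 : ℝ))) Filter.atTop (nhds 0) := by
      have := (tendsto_one_div_add_atTop_nhds_zero_nat (𝕜 := ℝ)).const_mul (-‖y‖ ^ 2 / 2)
      rw [mul_zero] at this
      refine this.congr fun n => ?_
      field_simp
    have := ((Real.continuous_exp.tendsto 0).comp h1).mul_const (f y)
    simpa using this
  · exact (Measurable.mul (by fun_prop) hf).ennreal_ofReal

end HeatZero

section Flow

variable {k m : ℕ}
  {E : Fin k → Type*} {F : Fin m → Type*}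
  [∀ i, NormedAddCommGroup (E i)] [∀ i, InnerProductSpace ℝ (E i)]
  [∀ i, FiniteDimensional ℝ (E i)]
  [∀ i, MeasurableSpace (E i)] [∀ i, BorelSpace (E i)]
  [∀ j, NormedAddCommGroup (F j)] [∀ j, InnerProductSpace ℝ (F j)]
  [∀ j, FiniteDimensional ℝ (F j)]
  [∀ j, MeasurableSpace (F j)] [∀ j, BorelSpace (F j)]
  {c : Fin k → ℝ} {d : Fin m → ℝ} {B : ∀ i j, E i →ₗ[ℝ] F j}
  {H : Type*} [NormedAddCommGroup H] [InnerProductSpace ℝ H] [FiniteDimensional ℝ H]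
  {A : ∀ i, H →ₗ[ℝ] E i}

lemma GaussCoupling.prod_lintegral_le
    (hA : GaussCoupling E F c B A) (hc : ∀ i, 0 < c i) (hd : ∀ j, 0 < d j)
    (hG : ∀ x : ∀ i, E i, ∑ j, d j * ‖∑ i, c i • B i j (x i)‖ ^ 2 ≤ ∑ i, c i * ‖x i‖ ^ 2)
    (hsc : ScalingCond E F c d)
    {L M : ℝ} (hL : 0 ≤ L) (hM : 0 ≤ M) {f : ∀ i, E i → ℝ} {g : ∀ j, F j → ℝ}
    (hf : ∀ i, Reg L M (f i)) (hg : ∀ j, ExpBdd (g j))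
    (hfg : ∀ x : ∀ i, E i, ∑ i, c i * Real.log (f i (x i)) ≤
      ∑ j, d j * Real.log (g j (∑ i, c i • B i j (x i)))) :
    ∏ i, (∫⁻ x, ENNReal.ofReal (f i x)) ^ c i ≤ ∏ j, (∫⁻ y, ENNReal.ofReal (g j y)) ^ d j := by
  borelize H
  refine prod_rpow_le_of_le_liminf hc (fun i => lintegral_le_liminf_exp_mul (hf i).meas)
    (Filter.Eventually.of_forall fun n => ?_)
  set T : ℝ := n + 1 with hT
  have hT0 : 0 < T := by positivity
  have hfp (i) : 0 < heat T (f i) 0 := ((hf i).heat T).pos 0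
  have hgp (j) : 0 < heat T (g j) 0 := ((hg j).heat T).pos 0
  have h := hA.log_heat_le hc hd hG hL hM hf hg hfg hT0.le 0
  simp only [Pi.zero_apply, map_zero, smul_zero, Finset.sum_const_zero,
    log_heat_apply_zero hT0 (hfp _), log_heat_apply_zero hT0 (hgp _), mul_sub,
    Finset.sum_sub_distrib, mul_left_comm _ (Real.log (2 * Real.pi * T) / 2),
    ← Finset.mul_sum] at h
  rw [show ∑ i, c i * (Module.finrank ℝ (E i) : ℝ) = _ from hsc, sub_le_sub_iff_right] at h
  have h2 := ENNReal.ofReal_le_ofReal (Real.exp_le_exp.2 h)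
  rw [ofReal_exp_sum_mul_log _ fun i => integral_exp_mul_pos_of_heat_pos hT0 (hfp i),
    ofReal_exp_sum_mul_log _ fun j => integral_exp_mul_pos_of_heat_pos hT0 (hgp j)] at h2
  simp only [ofReal_integral_exp_mul_of_heat_pos hT0 (hfp _) (hf _).pos,
    ofReal_integral_exp_mul_of_heat_pos hT0 (hgp _) (hg _).pos] at h2
  refine h2.trans (Finset.prod_le_prod' fun j _ => ENNReal.rpow_le_rpow
    (lintegral_mono fun y => ENNReal.ofReal_le_ofReal ?_) (hd j).le)
  refine mul_le_of_le_one_left ((hg j).pos y).le (Real.exp_le_one_iff.2 ?_)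
  have : 0 ≤ ‖y‖ ^ 2 / (2 * T) := by positivity
  rw [neg_div]; linarith

end Flow

end FRBL

namespace FRBL

section Smoothing

variable {G : Type*} [NormedAddCommGroup G] [InnerProductSpace ℝ G] [FiniteDimensional ℝ G]
  [MeasurableSpace G] [BorelSpace G]

lemma Reg.of_exp {L M : ℝ} {v : G → ℝ} {θ : G → G} (hL : 0 ≤ L) (hM : 0 ≤ M)
    (hv : ∀ x y, |v (x + y) - v x| ≤ L * ‖y‖) (hθm : Measurable θ) (hθ : ∀ x, ‖θ x‖ ≤ L)
    (h : ∀ x y, |v (x + y) - v x - ⟪θ x, y⟫| ≤ M * ‖y‖ ^ 2) :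
    Reg L (M + L ^ 2) fun x => Real.exp (v x) := by
  have hvc : Continuous v := by
    have : LipschitzWith (Real.toNNReal L) v := LipschitzWith.of_dist_le_mul fun x y => by
      rw [Real.coe_toNNReal _ hL, Real.dist_eq, dist_eq_norm]
      simpa using hv y (x - y)
    exact this.continuous
  have hvm := hvc.measurable
  refine ⟨by fun_prop, fun x => Real.exp_pos _, fun x y => ?_,
    fun x => Real.exp (v x) • θ x, by fun_prop, fun x => ⟨?_, fun y => ?_⟩⟩
  · rw [← Real.exp_add]
    exact Real.exp_le_exp.2 (by linarith [(abs_le.1 (hv x y)).2])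
  · rw [norm_smul, Real.norm_of_nonneg (Real.exp_pos _).le, mul_comm]
    exact mul_le_mul_of_nonneg_right (hθ x) (Real.exp_pos _).le
  · set s := v (x + y) - v x with hs
    have e : Real.exp (v (x + y)) - Real.exp (v x) - ⟪Real.exp (v x) • θ x, y⟫ =
        ((Real.exp s - 1 - s) + (s - ⟪θ x, y⟫)) * Real.exp (v x) := by
      have : Real.exp (v (x + y)) = Real.exp s * Real.exp (v x) := by
        rw [← Real.exp_add, hs]; congr 1; ring
      rw [this, real_inner_smul_left]; ring
    rw [e, abs_mul, abs_of_pos (Real.exp_pos (v x))]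
    refine mul_le_mul_of_nonneg_right ?_ (Real.exp_pos _).le
    have h1 := abs_exp_sub_one_sub_le s
    have hsv : |s| ≤ L * ‖y‖ := hv x y
    have h2 : s ^ 2 * Real.exp |s| ≤ (L * ‖y‖) ^ 2 * Real.exp (L * ‖y‖) := by
      have : s ^ 2 ≤ (L * ‖y‖) ^ 2 := by rw [← sq_abs s]; gcongr
      gcongr
    have h3 : M * ‖y‖ ^ 2 ≤ M * ‖y‖ ^ 2 * Real.exp (L * ‖y‖) :=
      le_mul_of_one_le_right (by positivity) (Real.one_le_exp (by positivity))
    have h4 := h x y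
    rw [← hs] at h4
    refine (abs_add_le _ _).trans ?_
    nlinarith

lemma Reg.mono {L M L' M' : ℝ} {f : G → ℝ} (hf : Reg L M f) (hM0 : 0 ≤ M)
    (hL : L ≤ L') (hM : M ≤ M') : Reg L' M' f := by
  have hp := hf.pos
  obtain ⟨D, hDm, hD⟩ := hf.diff
  refine ⟨hf.meas, hf.pos, fun x y => (hf.lip x y).trans ?_, D, hDm, fun x =>
    ⟨(hD x).1.trans ?_, fun y => ((hD x).2 y).trans ?_⟩⟩
  · have := (hp x).le
    gcongr
  · have := (hp x).le
    gcongr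
  · have := (hp x).le
    have : 0 ≤ M' := hM0.trans hM
    gcongr

/-- Functions that are Lipschitz at large scales. -/
structure CoarseLip (l C : ℝ) (u : G → ℝ) : Prop where
  meas : Measurable u
  le : ∀ x y, |u (x + y) - u x| ≤ l * ‖y‖ + C

variable {H : Type*} [NormedAddCommGroup H] [NormedSpace ℝ H]

lemma integrable_and_norm_integral_le_of_ball {f : G → H} {R S : ℝ}
    (hm : AEStronglyMeasurable f volume) (h0 : ∀ z, R < ‖z‖ → f z = 0)
    (hb : ∀ z, ‖z‖ ≤ R → ‖f z‖ ≤ S) :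
    Integrable f ∧ ‖∫ z, f z‖ ≤ S * volume.real (Metric.closedBall (0 : G) R) := by
  have hi : Integrable ((Metric.closedBall (0 : G) R).indicator fun _ => S) :=
    (integrable_indicator_iff Metric.isClosed_closedBall.measurableSet).2
      (integrableOn_const (isCompact_closedBall _ _).measure_lt_top.ne)
  have hle (z : G) : ‖f z‖ ≤ (Metric.closedBall (0 : G) R).indicator (fun _ => S) z := by
    by_cases hz : ‖z‖ ≤ R
    · rw [Set.indicator_of_mem (by simpa using hz)]
      exact hb z hz
    · rw [Set.indicator_of_notMem (by simpa using hz), h0 z (not_le.1 hz), norm_zero]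
  refine ⟨hi.mono' hm (Filter.Eventually.of_forall hle), ?_⟩
  refine (norm_integral_le_of_norm_le hi (Filter.Eventually.of_forall hle)).trans (le_of_eq ?_)
  rw [integral_indicator Metric.isClosed_closedBall.measurableSet, setIntegral_const, smul_eq_mul,
    mul_comm]

lemma exists_bump_bounds (φ : ContDiffBump (0 : G)) : ∃ K, 0 ≤ K ∧
    (∀ z, ‖fderiv ℝ (φ.normed volume) z‖ ≤ K) ∧
    (∀ z y, |φ.normed volume (z - y) - φ.normed volume z| ≤ K * ‖y‖) ∧
    (∀ z y, |φ.normed volume (z - y) - φ.normed volume z + fderiv ℝ (φ.normed volume) z y| ≤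
      K * ‖y‖ ^ 2) := by
  set ψ := φ.normed (volume : Measure G) with hψ
  have hsm : ContDiff ℝ 2 ψ := φ.contDiff_normed (n := 2)
  have hcs : HasCompactSupport ψ := φ.hasCompactSupport_normed
  have hsm' : ContDiff ℝ 1 (fderiv ℝ ψ) := hsm.fderiv_right (by norm_num)
  have hdiff : Differentiable ℝ ψ := hsm.differentiable (by norm_num)
  obtain ⟨K₁, hK₁⟩ := (hcs.fderiv ℝ).exists_bound_of_continuous hsm'.continuous
  obtain ⟨K₂, hK₂⟩ := ContDiff.lipschitzWith_of_hasCompactSupport (hcs.fderiv ℝ) hsm' (by norm_num)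
  have hK10 : 0 ≤ K₁ := (norm_nonneg _).trans (hK₁ 0)
  refine ⟨K₁ + K₂, by positivity, fun z => (hK₁ z).trans (by simp), fun z y => ?_, fun z y => ?_⟩
  · have := convex_univ.norm_image_sub_le_of_norm_fderiv_le (fun x _ => hdiff x)
      (fun x _ => hK₁ x) (Set.mem_univ z) (Set.mem_univ (z - y))
    rw [Real.norm_eq_abs, sub_sub_cancel_left, norm_neg] at this
    refine this.trans ?_
    gcongr; simp
  · have := (convex_closedBall z ‖y‖).norm_image_sub_le_of_norm_fderiv_le'
      (f := ψ) (φ := fderiv ℝ ψ z) (C := K₂ * ‖y‖) (x := z) (y := z - y) (fun x _ => hdiff x)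
      (fun x hx => ?_) (by simp) (by simp)
    · rw [Real.norm_eq_abs, sub_sub_cancel_left, map_neg, sub_neg_eq_add, norm_neg] at this
      refine this.trans ?_
      rw [mul_assoc, ← sq]
      gcongr; simpa using hK10
    · have h1 := hK₂.dist_le_mul x z
      rw [dist_eq_norm] at h1
      refine h1.trans ?_
      gcongr
      simpa using hx

/-- The probability measure whose density is a normalised bump function. -/
def bumpMeasure (φ : ContDiffBump (0 : G)) : Measure G :=
  volume.withDensity fun x => ENNReal.ofReal (φ.normed volume x)

lemma integral_bumpMeasure (φ : ContDiffBump (0 : G)) (f : G → H) :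
    ∫ z, f z ∂(bumpMeasure φ) = ∫ z, φ.normed volume z • f z := by
  have hm : Measurable fun x : G => Real.toNNReal (φ.normed volume x) :=
    φ.continuous_normed.measurable.real_toNNReal
  rw [bumpMeasure]
  simp only [ENNReal.ofReal]
  rw [integral_withDensity_eq_integral_smul hm]
  refine integral_congr_ae (Filter.Eventually.of_forall fun z => ?_)
  simp only [NNReal.smul_def]
  rw [Real.coe_toNNReal _ (φ.nonneg_normed z)]

instance (φ : ContDiffBump (0 : G)) : IsProbabilityMeasure (bumpMeasure φ) := by
  constructor
  rw [bumpMeasure, withDensity_apply _ MeasurableSet.univ, Measure.restrict_univ,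
    ← ofReal_integral_eq_lintegral_ofReal φ.integrable_normed
      (Filter.Eventually.of_forall φ.nonneg_normed), φ.integral_normed, ENNReal.ofReal_one]

lemma integrable_bumpMeasure_iff (φ : ContDiffBump (0 : G)) (f : G → ℝ) :
    Integrable f (bumpMeasure φ) ↔ Integrable (fun z => φ.normed volume z * f z) := by
  have hm : Measurable fun x : G => Real.toNNReal (φ.normed volume x) :=
    φ.continuous_normed.measurable.real_toNNReal
  rw [bumpMeasure]
  simp only [ENNReal.ofReal]
  rw [integrable_withDensity_iff_integrable_smul hm]
  refine integrable_congr (Filter.Eventually.of_forall fun z => ?_)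
  simp only [NNReal.smul_def, smul_eq_mul]
  rw [Real.coe_toNNReal _ (φ.nonneg_normed z)]

variable {l C : ℝ} {u : G → ℝ}

lemma normed_bump_eq_zero {φ : ContDiffBump (0 : G)} (hφ : φ.rOut ≤ 1) {z : G} (hz : 1 < ‖z‖) :
    φ.normed volume z = 0 := by
  have : z ∉ Function.support (φ.normed (volume : Measure G)) := by
    rw [φ.support_normed_eq, mem_ball_zero_iff]
    linarith
  simpa using this

lemma fderiv_normed_bump_eq_zero {φ : ContDiffBump (0 : G)} (hφ : φ.rOut ≤ 1) {z : G}
    (hz : 1 < ‖z‖) : fderiv ℝ (φ.normed volume) z = 0 := by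
  by_contra h
  have h1 := support_fderiv_subset ℝ (Function.mem_support.2 h)
  rw [φ.tsupport_normed_eq, mem_closedBall_zero_iff] at h1
  linarith

lemma CoarseLip.integrable_bumpMeasure (hu : CoarseLip l C u) (hl : 0 ≤ l)
    {φ : ContDiffBump (0 : G)} (hφ : φ.rOut ≤ 1) (x : G) :
    Integrable (fun z => u (x + z)) (bumpMeasure φ) := by
  rw [integrable_bumpMeasure_iff]
  have hψm := φ.continuous_normed (μ := volume) |>.measurable
  have hum := hu.meas
  obtain ⟨S, hS⟩ := (φ.hasCompactSupport_normed (μ := volume)).exists_bound_of_continuous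
    φ.continuous_normed
  refine (integrable_and_norm_integral_le_of_ball (R := 1) (S := S * (|u x| + l + C))
    (by fun_prop) (fun z hz => by simp [normed_bump_eq_zero hφ hz]) fun z hz => ?_).1
  rw [norm_mul]
  have h1 := hu.le x z
  have h2 := abs_sub_abs_le_abs_sub (u (x + z)) (u x)
  have h3 : l * ‖z‖ ≤ l := mul_le_of_le_one_right hl hz
  have hS0 : 0 ≤ S := (norm_nonneg _).trans (hS 0)
  refine mul_le_mul (hS z) ?_ (norm_nonneg _) hS0
  rw [Real.norm_eq_abs]
  linarith

lemma CoarseLip.exists_reg (hu : CoarseLip l C u) (hl : 0 ≤ l) (hC : 0 ≤ C)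
    {φ : ContDiffBump (0 : G)} (hφ : φ.rOut ≤ 1) :
    ∃ L M, 0 ≤ L ∧ 0 ≤ M ∧ Reg L M fun x => Real.exp (∫ z, u (x + z) ∂(bumpMeasure φ)) := by
  obtain ⟨K, hK, hK0, hK1, hK2⟩ := exists_bump_bounds φ
  set ψ := φ.normed (volume : Measure G) with hψ
  set V := volume.real (Metric.closedBall (0 : G) 2) with hV
  have hV0 : 0 ≤ V := measureReal_nonneg
  set v : G → ℝ := fun x => ∫ z, u (x + z) ∂(bumpMeasure φ) with hv
  have hui (x : G) := hu.integrable_bumpMeasure hl hφ x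
  have hψm : Measurable ψ := φ.continuous_normed.measurable
  have hum := hu.meas
  have hψi : Integrable ψ := φ.integrable_normed
  have hψ1 : ∫ z, ψ z = 1 := φ.integral_normed
  have hψu (x : G) : Integrable fun z => ψ z * u (x + z) :=
    (integrable_bumpMeasure_iff φ _).1 (hui x)
  have hψu' (x y : G) : Integrable fun z => ψ (z - y) * u (x + z) := by
    have := (hψu (x + y)).comp_sub_right y
    refine this.congr (Filter.Eventually.of_forall fun z => ?_)
    simp only [add_assoc, add_sub_cancel]
  have hψw (x y : G) : Integrable fun z => ψ (z - y) * (u (x + z) - u x) := by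
    simp only [mul_sub]
    exact (hψu' x y).sub ((hψi.comp_sub_right y).mul_const _)
  have hvw (x y : G) : v (x + y) - u x = ∫ z, ψ (z - y) * (u (x + z) - u x) := by
    simp only [mul_sub]
    rw [integral_sub (hψu' x y) ((hψi.comp_sub_right y).mul_const _), integral_mul_const,
      integral_sub_right_eq_self ψ, hψ1, one_mul, hv]
    simp only
    rw [integral_bumpMeasure, ← integral_sub_right_eq_self _ y]
    simp only [smul_eq_mul, add_assoc, add_sub_cancel, hψ]
  have hwb (x z : G) (hz : ‖z‖ ≤ 2) : |u (x + z) - u x| ≤ 2 * l + C :=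
    (hu.le x z).trans (by nlinarith)
  have hvd (x y : G) : v (x + y) - v x = ∫ z, (ψ (z - y) - ψ z) * (u (x + z) - u x) := by
    have h0 := hvw x 0
    simp only [add_zero, sub_zero] at h0
    have h00 := hψw x 0
    simp only [sub_zero] at h00
    simp only [sub_mul _ _ (u _ - _)]
    rw [integral_sub (hψw x y) h00, ← hvw, ← h0]
    ring
  have hz2 {y z : G} (hy : ‖y‖ ≤ 1) (hz : 2 < ‖z‖) : ψ (z - y) - ψ z = 0 := by
    have h := norm_sub_norm_le z y
    rw [hψ, normed_bump_eq_zero hφ (by linarith), normed_bump_eq_zero hφ (by linarith), sub_zero]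
  have hz2' {z : G} (hz : 2 < ‖z‖) : fderiv ℝ ψ z = 0 :=
    fderiv_normed_bump_eq_zero hφ (by linarith)
  have hlarge (x y : G) : |v (x + y) - v x| ≤ l * ‖y‖ + C := by
    rw [hv]
    simp only
    rw [← integral_sub (hui _) (hui _)]
    have := norm_integral_le_of_norm_le_const (μ := bumpMeasure φ)
      (f := fun z => u (x + y + z) - u (x + z)) (C := l * ‖y‖ + C)
      (Filter.Eventually.of_forall fun z => by
        rw [Real.norm_eq_abs, add_right_comm]; exact hu.le _ _)
    simpa using this
  set p : G → G := fun z => (InnerProductSpace.toDual ℝ G).symm (fderiv ℝ ψ z) with hp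
  have hpn (z : G) : ‖p z‖ ≤ K := by
    rw [hp]; simp only [LinearIsometryEquiv.norm_map]; exact hK0 z
  have hpi (z y : G) : ⟪p z, y⟫ = fderiv ℝ ψ z y := InnerProductSpace.toDual_symm_apply
  have hfc : Continuous (fderiv ℝ ψ) :=
    (φ.contDiff_normed (μ := volume) (n := 1)).continuous_fderiv (by norm_num)
  have hpm : Measurable p :=
    ((InnerProductSpace.toDual ℝ G).symm.continuous.comp hfc).measurable
  set θ : G → G := fun x => -∫ z, (u (x + z) - u x) • p z with hθ
  have hθi (x : G) := integrable_and_norm_integral_le_of_ball (R := 2) (S := (2 * l + C) * K)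
    (f := fun z => (u (x + z) - u x) • p z) (by fun_prop)
    (fun z hz => by simp [hp, hz2' hz]) fun z hz => by
      rw [norm_smul]
      exact mul_le_mul (hwb x z hz) (hpn z) (norm_nonneg _) (by positivity)
  set L := (2 * l + C) * K * V + l + C with hL
  have hL0 : 0 ≤ L := by positivity
  have hLV : (2 * l + C) * K * V ≤ L := by rw [hL]; linarith
  have hLl : l + C ≤ L := by
    have : 0 ≤ (2 * l + C) * K * V := by positivity
    rw [hL]; linarith
  have hvL (x y : G) : |v (x + y) - v x| ≤ L * ‖y‖ := by
    rcases le_total ‖y‖ 1 with hy | hy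
    · rw [hvd]
      have := (integrable_and_norm_integral_le_of_ball (R := 2) (S := (2 * l + C) * (K * ‖y‖))
        (f := fun z => (ψ (z - y) - ψ z) * (u (x + z) - u x)) (by fun_prop)
        (fun z hz => by simp [hz2 hy hz]) fun z hz => by
          rw [norm_mul, mul_comm]
          exact mul_le_mul (hwb x z hz) (hK1 z y) (norm_nonneg _) (by positivity)).2
      refine this.trans ?_
      have := mul_le_mul_of_nonneg_right hLV (norm_nonneg y)
      linarith
    · refine (hlarge x y).trans ?_
      nlinarith
  refine ⟨L, 2 * L + L ^ 2, hL0, by positivity,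
    Reg.of_exp (θ := θ) hL0 (by positivity) hvL ?_ (fun x => ?_) fun x y => ?_⟩
  · refine Measurable.neg ?_
    have : Measurable fun q : G × G => (u (q.1 + q.2) - u q.1) • p q.2 := by fun_prop
    exact (StronglyMeasurable.integral_prod_right
      (f := fun x z => (u (x + z) - u x) • p z) this.stronglyMeasurable).measurable
  · rw [hθ, norm_neg]
    exact (hθi x).2.trans hLV
  · rcases le_total ‖y‖ 1 with hy | hy
    · have e : v (x + y) - v x - ⟪θ x, y⟫ =
          ∫ z, (ψ (z - y) - ψ z + fderiv ℝ ψ z y) * (u (x + z) - u x) := by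
        have h1 : ⟪θ x, y⟫ = -∫ z, fderiv ℝ ψ z y * (u (x + z) - u x) := by
          rw [hθ]
          simp only
          rw [inner_neg_left, real_inner_comm, ← integral_inner (hθi x).1]
          congr 2; ext z
          rw [real_inner_comm, real_inner_smul_left, hpi, mul_comm]
        have h2 : Integrable fun z => (ψ (z - y) - ψ z) * (u (x + z) - u x) := by
          have h00 := hψw x 0
          simp only [sub_zero] at h00
          simp only [sub_mul _ _ (u _ - _)]
          exact (hψw x y).sub h00
        have h3 : Integrable fun z => fderiv ℝ ψ z y * (u (x + z) - u x) := by
          refine ((hθi x).1.inner_const y).congr (Filter.Eventually.of_forall fun z => ?_)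
          simp only [real_inner_smul_left, hpi, mul_comm]
        rw [h1, hvd, sub_neg_eq_add, ← integral_add h2 h3]
        simp only [add_mul]
      have hfm : Measurable fun z => fderiv ℝ ψ z y := (hfc.clm_apply continuous_const).measurable
      rw [e]
      have := (integrable_and_norm_integral_le_of_ball (R := 2)
        (S := (2 * l + C) * (K * ‖y‖ ^ 2))
        (f := fun z => (ψ (z - y) - ψ z + fderiv ℝ ψ z y) * (u (x + z) - u x)) (by fun_prop)
        (fun z hz => by simp [hz2 hy hz, hz2' hz]) fun z hz => by
          rw [norm_mul, mul_comm]
          exact mul_le_mul (hwb x z hz) (hK2 z y) (norm_nonneg _) (by positivity)).2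
      refine this.trans ?_
      have := mul_le_mul_of_nonneg_right hLV (sq_nonneg ‖y‖)
      nlinarith [mul_nonneg hL0 (sq_nonneg ‖y‖)]
    · have h1 := hvL x y
      have h2 : |⟪θ x, y⟫| ≤ L * ‖y‖ := by
        refine (abs_real_inner_le_norm _ _).trans ?_
        gcongr
        rw [hθ, norm_neg]
        exact (hθi x).2.trans hLV
      refine (abs_sub _ _).trans ?_
      have : L * ‖y‖ ≤ L * ‖y‖ ^ 2 := by gcongr; nlinarith
      linarith

end Smoothing

end FRBL

namespace FRBL

section

variable {G : Type*} [NormedAddCommGroup G] [InnerProductSpace ℝ G] [FiniteDimensional ℝ G]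
  [MeasurableSpace G] [BorelSpace G]

lemma ExpBdd.lintegral_average {g : G → ℝ} (hg : ExpBdd g) {Ω : Type*} [MeasurableSpace Ω]
    {P : Measure Ω} [IsProbabilityMeasure P] {Y : Ω → G} (hY : Measurable Y) :
    ∫⁻ y, ENNReal.ofReal (∫ ω, g (y + Y ω) ∂P) = ∫⁻ y, ENNReal.ofReal (g y) := by
  have hm := hg.meas
  have h1 (y : G) : ENNReal.ofReal (∫ ω, g (y + Y ω) ∂P) = ∫⁻ ω, ENNReal.ofReal (g (y + Y ω)) ∂P :=
    ofReal_integral_eq_lintegral_ofReal (hg.integrable_comp hY y)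
      (Filter.Eventually.of_forall fun ω => (hg.pos _).le)
  simp only [h1]
  rw [lintegral_lintegral_swap (by fun_prop)]
  have h2 (ω : Ω) : ∫⁻ y, ENNReal.ofReal (g (y + Y ω)) = ∫⁻ y, ENNReal.ofReal (g y) :=
    lintegral_add_right_eq_self (fun y => ENNReal.ofReal (g y)) (Y ω)
  simp [h2]

lemma CoarseLip.ae_tendsto {l C : ℝ} {u : G → ℝ} (hu : CoarseLip l C u)
    {φ : ℕ → ContDiffBump (0 : G)}
    (hφ : Filter.Tendsto (fun n => (φ n).rOut) Filter.atTop (nhds 0)) {K : ℝ}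
    (hK : ∀ n, (φ n).rOut ≤ K * (φ n).rIn) :
    ∀ᵐ x, Filter.Tendsto (fun n => ∫ z, u (x + z) ∂(bumpMeasure (φ n))) Filter.atTop
      (nhds (u x)) := by
  have hloc : LocallyIntegrable u volume := by
    have hcont : Continuous fun x : G => |u 0| + (l * ‖x‖ + C) := by fun_prop
    refine (hcont.locallyIntegrable).mono hu.meas.aestronglyMeasurable
      (Filter.Eventually.of_forall fun x => ?_)
    have h := hu.le 0 x
    rw [zero_add] at h
    rw [Real.norm_eq_abs, Real.norm_eq_abs]
    refine le_trans ?_ (le_abs_self _)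
    have := abs_add_le (u x - u 0) (u 0)
    rw [sub_add_cancel] at this
    linarith
  filter_upwards [ContDiffBump.ae_convolution_tendsto_right_of_locallyIntegrable hφ
    (Filter.Eventually.of_forall hK) hloc] with x hx
  refine hx.congr fun n => ?_
  rw [integral_bumpMeasure, ← integral_neg_eq_self]
  simp [convolution, ContDiffBump.normed_neg, sub_eq_add_neg]

lemma lintegral_exp_le_liminf {u : G → ℝ} {v : ℕ → G → ℝ} (hv : ∀ n, Measurable (v n))
    (h : ∀ᵐ x, Filter.Tendsto (fun n => v n x) Filter.atTop (nhds (u x))) :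
    ∫⁻ x, ENNReal.ofReal (Real.exp (u x)) ≤
      Filter.liminf (fun n => ∫⁻ x, ENNReal.ofReal (Real.exp (v n x))) Filter.atTop := by
  refine le_trans (le_of_eq (lintegral_congr_ae ?_)) (lintegral_liminf_le fun n => ?_)
  · filter_upwards [h] with x hx
    exact (ENNReal.tendsto_ofReal ((Real.continuous_exp.tendsto _).comp hx)).liminf_eq.symm
  · have := hv n
    fun_prop

end

lemma exists_bump_seq (G : Type*) [NormedAddCommGroup G] [InnerProductSpace ℝ G]
    [FiniteDimensional ℝ G] : ∃ φ : ℕ → ContDiffBump (0 : G),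
    Filter.Tendsto (fun n => (φ n).rOut) Filter.atTop (nhds 0) ∧
    (∀ n, (φ n).rOut ≤ 2 * (φ n).rIn) ∧ ∀ n, (φ n).rOut ≤ 1 := by
  refine ⟨fun n => ⟨1 / (n + 1) / 2, 1 / (n + 1), by positivity, half_lt_self (by positivity)⟩,
    tendsto_one_div_add_atTop_nhds_zero_nat, fun n => ?_, fun n => ?_⟩
  · exact le_of_eq (by simp only; ring)
  · simp only
    rw [div_le_one (by positivity)]
    linarith [(Nat.cast_nonneg n : (0 : ℝ) ≤ n)]

variable {k m : ℕ}
  {E : Fin k → Type*} {F : Fin m → Type*}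
  [∀ i, NormedAddCommGroup (E i)] [∀ i, InnerProductSpace ℝ (E i)]
  [∀ i, FiniteDimensional ℝ (E i)]
  [∀ i, MeasurableSpace (E i)] [∀ i, BorelSpace (E i)]
  [∀ j, NormedAddCommGroup (F j)] [∀ j, InnerProductSpace ℝ (F j)]
  [∀ j, FiniteDimensional ℝ (F j)]
  [∀ j, MeasurableSpace (F j)] [∀ j, BorelSpace (F j)]
  {c : Fin k → ℝ} {d : Fin m → ℝ} {B : ∀ i j, E i →ₗ[ℝ] F j}
  {H : Type*} [NormedAddCommGroup H] [InnerProductSpace ℝ H] [FiniteDimensional ℝ H]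
  {A : ∀ i, H →ₗ[ℝ] E i}

lemma GaussCoupling.prod_lintegral_exp_le
    (hA : GaussCoupling E F c B A) (hc : ∀ i, 0 < c i) (hd : ∀ j, 0 < d j)
    (hG : ∀ x : ∀ i, E i, ∑ j, d j * ‖∑ i, c i • B i j (x i)‖ ^ 2 ≤ ∑ i, c i * ‖x i‖ ^ 2)
    (hsc : ScalingCond E F c d)
    {l C : ℝ} (hl : 0 ≤ l) (hC : 0 ≤ C) {u : ∀ i, E i → ℝ} {g : ∀ j, F j → ℝ}
    (hu : ∀ i, CoarseLip l C (u i)) (hg : ∀ j, ExpBdd (g j))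
    (hug : ∀ x : ∀ i, E i, ∑ i, c i * u i (x i) ≤
      ∑ j, d j * Real.log (g j (∑ i, c i • B i j (x i)))) :
    ∏ i, (∫⁻ x, ENNReal.ofReal (Real.exp (u i x))) ^ c i ≤
      ∏ j, (∫⁻ y, ENNReal.ofReal (g j y)) ^ d j := by
  choose φ hφ0 hφ2 hφ1 using fun i => exists_bump_seq (E i)
  set v : ∀ i, ℕ → E i → ℝ := fun i n x => ∫ z, u i (x + z) ∂(bumpMeasure (φ i n)) with hv
  choose L M hL hM hR using fun i n => (hu i).exists_reg hl hC (hφ1 i n)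
  have hvm (i n) : Measurable (v i n) := by
    have := (hR i n).meas.log
    simpa only [Real.log_exp] using this
  refine prod_rpow_le_of_le_liminf hc
    (fun i => lintegral_exp_le_liminf (hvm i) ((hu i).ae_tendsto (hφ0 i) (hφ2 i)))
    (Filter.Eventually.of_forall fun n => ?_)
  set ν : Measure (∀ i, E i) := Measure.pi fun i => bumpMeasure (φ i n) with hν
  have hmp (i) : MeasurePreserving (fun z : ∀ i, E i => z i) ν (bumpMeasure (φ i n)) :=
    measurePreserving_eval _ i
  set Y : ∀ j, (∀ i, E i) → F j := fun j z => ∑ i, c i • B i j (z i) with hY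
  have hYm (j) : Measurable (Y j) := by
    refine Finset.measurable_sum _ fun i _ => ?_
    have := (B i j).continuous_of_finiteDimensional.measurable
    fun_prop
  have hui (i) (x : E i) : Integrable (fun z : ∀ i, E i => u i (x + z i)) ν :=
    (hmp i).integrable_comp_of_integrable ((hu i).integrable_bumpMeasure hl (hφ1 i n) x)
  have hni (i) : Integrable (fun z : ∀ i, E i => ‖z i‖) ν := by
    have hcl : CoarseLip 1 0 (fun z : E i => ‖z‖) := ⟨measurable_norm, fun x y => by
      have := abs_norm_sub_norm_le (x + y) x
      simpa using this⟩
    have := hcl.integrable_bumpMeasure zero_le_one (hφ1 i n) 0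
    simp only [zero_add] at this
    exact (hmp i).integrable_comp_of_integrable this
  have hYi (j) : Integrable (fun z => ‖Y j z‖) ν := by
    have h1 : Integrable (fun z : ∀ i, E i =>
        ∑ i, ‖c i • LinearMap.toContinuousLinearMap (B i j)‖ * ‖z i‖) ν :=
      integrable_finsetSum _ fun i _ => (hni i).const_mul _
    refine h1.mono' (hYm j).norm.aestronglyMeasurable (Filter.Eventually.of_forall fun z => ?_)
    rw [norm_norm]
    refine (norm_sum_le _ _).trans (Finset.sum_le_sum fun i _ => ?_)
    exact (c i • LinearMap.toContinuousLinearMap (B i j)).le_opNorm (z i)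
  have key := hA.prod_lintegral_le hc hd hG hsc (L := ∑ i, L i n) (M := ∑ i, M i n)
    (Finset.sum_nonneg fun i _ => hL i n) (Finset.sum_nonneg fun i _ => hM i n)
    (f := fun i x => Real.exp (v i n x)) (g := fun j y => ∫ z, g j (y + Y j z) ∂ν)
    (fun i => (hR i n).mono (hM i n)
      (Finset.single_le_sum (f := fun i => L i n) (fun i _ => hL i n) (Finset.mem_univ i))
      (Finset.single_le_sum (f := fun i => M i n) (fun i _ => hM i n) (Finset.mem_univ i)))
    (fun j => (hg j).average (hYm j)) fun x => ?_
  · simpa only [fun j => (hg j).lintegral_average (P := ν) (hYm j)] using key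
  · have hgi (j) (y : F j) : Integrable (fun z => Real.log (g j (y + Y j z))) ν :=
      (hg j).integrable_log_comp (hYm j) (hYi j) y
    have h1 (i) : v i n (x i) = ∫ z, u i (x i + z i) ∂ν := by
      rw [hv]
      simp only
      rw [← (hmp i).map_eq, integral_map (hmp i).aemeasurable]
      rw [(hmp i).map_eq]
      exact ((hu i).integrable_bumpMeasure hl (hφ1 i n) (x i)).aestronglyMeasurable
    have h2 (j) (y : F j) : ∫ z, Real.log (g j (y + Y j z)) ∂ν ≤
        Real.log (∫ z, g j (y + Y j z) ∂ν) :=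
      integral_log_le_log_integral (fun z => (hg j).pos _) ((hg j).integrable_comp (hYm j) y)
        (hgi j y)
    simp only [Real.log_exp, h1]
    calc ∑ i, c i * ∫ z, u i (x i + z i) ∂ν = ∫ z, ∑ i, c i * u i (x i + z i) ∂ν := by
          rw [integral_finsetSum _ fun i _ => (hui i (x i)).const_mul _]
          simp only [integral_const_mul]
      _ ≤ ∫ z, ∑ j, d j * Real.log (g j ((∑ i, c i • B i j (x i)) + Y j z)) ∂ν := by
          refine integral_mono (integrable_finsetSum _ fun i _ => (hui i (x i)).const_mul _)
            (integrable_finsetSum _ fun j _ => (hgi j _).const_mul _) fun z => ?_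
          refine (hug fun i => x i + z i).trans (le_of_eq ?_)
          simp only [hY, map_add, smul_add, Finset.sum_add_distrib]
      _ = ∑ j, d j * ∫ z, Real.log (g j ((∑ i, c i • B i j (x i)) + Y j z)) ∂ν := by
          rw [integral_finsetSum _ fun j _ => (hgi j _).const_mul _]
          simp only [integral_const_mul]
      _ ≤ _ := Finset.sum_le_sum fun j _ => mul_le_mul_of_nonneg_left (h2 j _) (hd j).le

end FRBL

namespace FRBL

section

variable {G : Type*} [NormedAddCommGroup G] [InnerProductSpace ℝ G] [FiniteDimensional ℝ G]
  [MeasurableSpace G] [BorelSpace G]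

lemma lintegral_exp_neg_norm_ne_top :
    ∫⁻ y : G, ENNReal.ofReal (Real.exp (-‖y‖)) ≠ ∞ := by
  set n := Module.finrank ℝ G + 1 with hn
  have h1 : Integrable (fun y : G => (1 + ‖y‖) ^ (-(n : ℝ))) :=
    integrable_one_add_norm (by rw [hn]; push_cast; linarith)
  have h2 : Integrable (fun y : G => Real.exp (-‖y‖)) := by
    refine (h1.const_mul (Real.exp 1 * n.factorial)).mono' (by fun_prop)
      (Filter.Eventually.of_forall fun y => ?_)
    have hp : 0 < 1 + ‖y‖ := by positivity
    have h3 := Real.pow_div_factorial_le_exp (1 + ‖y‖) hp.le n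
    rw [Real.norm_of_nonneg (Real.exp_pos _).le, Real.rpow_neg hp.le, Real.rpow_natCast,
      ← div_eq_mul_inv, le_div_iff₀ (by positivity)]
    rw [div_le_iff₀ (by positivity)] at h3
    calc Real.exp (-‖y‖) * (1 + ‖y‖) ^ n
        ≤ Real.exp (-‖y‖) * (Real.exp (1 + ‖y‖) * n.factorial) := by gcongr
      _ = Real.exp 1 * n.factorial := by
          rw [← mul_assoc, ← Real.exp_add]; ring_nf
  exact h2.lintegral_lt_top.ne

/-- The logarithm of `f`, cut off from below at height `e ^ (-N - l‖x‖)`. -/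
def logAbove (l N : ℝ) (f : G → ℝ≥0) (x : G) : ℝ :=
  Real.log (max (f x : ℝ) (Real.exp (-N - l * ‖x‖)))

section

variable {l N α : ℝ} {f : G → ℝ≥0}

lemma le_exp_logAbove (x : G) : (f x : ℝ) ≤ Real.exp (logAbove l N f x) := by
  rw [logAbove, Real.exp_log (lt_max_of_lt_right (Real.exp_pos _))]
  exact le_max_left _ _

lemma le_logAbove (x : G) : -N - l * ‖x‖ ≤ logAbove l N f x := by
  rw [logAbove, Real.le_log_iff_exp_le (lt_max_of_lt_right (Real.exp_pos _))]
  exact le_max_right _ _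

lemma logAbove_le (hα : -N ≤ α) {x : G} (hf : f x ≤ Real.exp (α - l * ‖x‖)) :
    logAbove l N f x ≤ α - l * ‖x‖ := by
  rw [logAbove, Real.log_le_iff_le_exp (lt_max_of_lt_right (Real.exp_pos _)), max_le_iff]
  exact ⟨hf, Real.exp_le_exp.2 (by linarith)⟩

lemma logAbove_eq (l N : ℝ) (f : G → ℝ≥0) (x : G) : logAbove l N f x = -N - l * ‖x‖ ∨
    0 < f x ∧ logAbove l N f x = Real.log (f x) := by
  rcases le_total (f x : ℝ) (Real.exp (-N - l * ‖x‖)) with h | h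
  · left
    rw [logAbove, max_eq_right h, Real.log_exp]
  · right
    rw [logAbove, max_eq_left h]
    exact ⟨by exact_mod_cast (Real.exp_pos _).trans_le h, rfl⟩

lemma coarseLip_logAbove (hl : 0 ≤ l) (hα : -N ≤ α) (hm : Measurable f)
    (hf : ∀ x, f x ≤ Real.exp (α - l * ‖x‖)) : CoarseLip l (α + N) (logAbove l N f) := by
  refine ⟨by unfold logAbove; fun_prop, fun x y => ?_⟩
  have h1 := logAbove_le hα (hf x)
  have h2 := logAbove_le hα (hf (x + y))
  have h3 := le_logAbove (l := l) (N := N) (f := f) x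
  have h4 := le_logAbove (l := l) (N := N) (f := f) (x + y)
  have h5 := abs_le.1 (abs_norm_sub_norm_le (x + y) x)
  rw [add_sub_cancel_left] at h5
  rw [abs_le]
  constructor <;> nlinarith [h5.1, h5.2]

end

/-- The function `g`, cut off from below at height `e ^ (-e - ‖y‖)` and from above at height
`e ^ N`. -/
def cutoff (e N : ℝ) (g : G → ℝ≥0) (y : G) : ℝ :=
  min (max (g y : ℝ) (Real.exp (-e - ‖y‖))) (Real.exp N)

section

variable {e N : ℝ} {g : G → ℝ≥0}

lemma exp_le_cutoff (he : -e ≤ N) (y : G) : Real.exp (-e - ‖y‖) ≤ cutoff e N g y :=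
  le_min (le_max_right _ _) (Real.exp_le_exp.2 (by linarith [norm_nonneg y]))

lemma cutoff_pos (y : G) : 0 < cutoff e N g y :=
  lt_min (lt_max_of_lt_right (Real.exp_pos _)) (Real.exp_pos _)

lemma neg_le_log_cutoff (he : -e ≤ N) (y : G) : -e - ‖y‖ ≤ Real.log (cutoff e N g y) :=
  (Real.le_log_iff_exp_le (cutoff_pos y)).2 (exp_le_cutoff he y)

lemma le_log_cutoff (e N : ℝ) (g : G → ℝ≥0) (y : G) : N ≤ Real.log (cutoff e N g y) ∨
    (g y : ℝ) ≤ cutoff e N g y := by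
  rcases le_total (max (g y : ℝ) (Real.exp (-e - ‖y‖))) (Real.exp N) with h | h
  · right
    rw [cutoff, min_eq_left h]
    exact le_max_left _ _
  · left
    rw [cutoff, min_eq_right h, Real.log_exp]

lemma expBdd_cutoff (he : -e ≤ N) (hm : Measurable g) : ExpBdd (cutoff e N g) := by
  refine ⟨by unfold cutoff; fun_prop, ⟨Real.exp N, fun y => min_le_right _ _⟩,
    Real.exp (-e), 1, Real.exp_pos _, zero_le_one, fun y => ?_⟩
  rw [← Real.exp_add, one_mul]
  exact exp_le_cutoff he y

lemma lintegral_cutoff_le (hm : Measurable g) :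
    ∫⁻ y, ENNReal.ofReal (cutoff e N g y) ≤
      (∫⁻ y, (g y : ℝ≥0∞)) + ENNReal.ofReal (Real.exp (-e)) *
        ∫⁻ y : G, ENNReal.ofReal (Real.exp (-‖y‖)) := by
  rw [← lintegral_const_mul _ (by fun_prop), ← lintegral_add_left (by fun_prop)]
  refine lintegral_mono fun y => ?_
  rw [← ENNReal.ofReal_mul (Real.exp_pos _).le, ← Real.exp_add, ← ENNReal.ofReal_coe_nnreal,
    ← ENNReal.ofReal_add (by positivity) (by positivity)]
  refine ENNReal.ofReal_le_ofReal ((min_le_left _ _).trans (max_le ?_ ?_))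
  · linarith [Real.exp_pos (-e + -‖y‖)]
  · rw [← sub_eq_add_neg]
    linarith [NNReal.coe_nonneg (g y)]

end

end

variable {k m : ℕ}
  {E : Fin k → Type*} {F : Fin m → Type*}
  [∀ i, NormedAddCommGroup (E i)] [∀ i, InnerProductSpace ℝ (E i)]
  [∀ i, FiniteDimensional ℝ (E i)]
  [∀ i, MeasurableSpace (E i)] [∀ i, BorelSpace (E i)]
  [∀ j, NormedAddCommGroup (F j)] [∀ j, InnerProductSpace ℝ (F j)]
  [∀ j, FiniteDimensional ℝ (F j)]
  [∀ j, MeasurableSpace (F j)] [∀ j, BorelSpace (F j)]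
  {c : Fin k → ℝ} {d : Fin m → ℝ} {B : ∀ i j, E i →ₗ[ℝ] F j}
  {H : Type*} [NormedAddCommGroup H] [InnerProductSpace ℝ H] [FiniteDimensional ℝ H]
  {A : ∀ i, H →ₗ[ℝ] E i}

lemma Hyp.sum_mul_log_le {f : ∀ i, E i → ℝ≥0} {g : ∀ j, F j → ℝ≥0} (h : Hyp E F c d B f g)
    (hd : ∀ j, 0 < d j) {g' : Fin m → ℝ} {x : ∀ i, E i} (hf : ∀ i, 0 < f i (x i))
    (hg : ∀ j, (g j (∑ i, c i • B i j (x i)) : ℝ) ≤ g' j) :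
    ∑ i, c i * Real.log (f i (x i)) ≤ ∑ j, d j * Real.log (g' j) := by
  have h1 := h x
  have h0 : 0 < ∏ i, f i (x i) ^ c i := Finset.prod_pos fun i _ => NNReal.rpow_pos (hf i)
  have hgp (j) : 0 < g j (∑ i, c i • B i j (x i)) := by
    by_contra h2
    rw [not_lt, nonpos_iff_eq_zero] at h2
    have h3 := h0.trans_le h1
    rw [Finset.prod_eq_zero (Finset.mem_univ j) (by rw [h2, NNReal.zero_rpow (hd j).ne'])] at h3
    exact lt_irrefl _ h3
  have e1 : Real.log ((∏ i, f i (x i) ^ c i : ℝ≥0) : ℝ) =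
      ∑ i, c i * Real.log (f i (x i)) := by
    push_cast
    rw [Real.log_prod fun i _ => (Real.rpow_pos_of_pos (by exact_mod_cast hf i) _).ne']
    exact Finset.sum_congr rfl fun i _ => Real.log_rpow (by exact_mod_cast hf i) _
  have e2 : Real.log ((∏ j, g j (∑ i, c i • B i j (x i)) ^ d j : ℝ≥0) : ℝ) =
      ∑ j, d j * Real.log (g j (∑ i, c i • B i j (x i))) := by
    push_cast
    rw [Real.log_prod fun j _ => (Real.rpow_pos_of_pos (by exact_mod_cast hgp j) _).ne']
    exact Finset.sum_congr rfl fun j _ => Real.log_rpow (by exact_mod_cast hgp j) _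
  rw [← e1]
  refine (Real.log_le_log (by exact_mod_cast h0) (NNReal.coe_le_coe.2 h1)).trans ?_
  rw [e2]
  refine Finset.sum_le_sum fun j _ => mul_le_mul_of_nonneg_left ?_ (hd j).le
  exact Real.log_le_log (by exact_mod_cast hgp j) (hg j)

lemma Hyp.sum_mul_logAbove_le {f : ∀ i, E i → ℝ≥0} {g : ∀ j, F j → ℝ≥0} (h : Hyp E F c d B f g)
    (hc : ∀ i, 0 < c i) (hd : ∀ j, 0 < d j) {l α e N S : ℝ} (hα : 0 ≤ α) (he : 0 ≤ e)
    (hN : 0 ≤ N)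
    (hl : ∀ x : ∀ i, E i, ∑ j, d j * ‖∑ i, c i • B i j (x i)‖ ≤ l * ∑ i, c i * ‖x i‖)
    (hf : ∀ i x, f i x ≤ Real.exp (α - l * ‖x‖)) (hS : S = α * ∑ i, c i + e * ∑ j, d j)
    (hcN : ∀ i, S ≤ c i * N) (hdN : ∀ j, S ≤ d j * N) (x : ∀ i, E i) :
    ∑ i, c i * logAbove l N (f i) (x i) ≤
      ∑ j, d j * Real.log (cutoff e N (g j) (∑ i, c i • B i j (x i))) := by
  set y : ∀ j, F j := fun j => ∑ i, c i • B i j (x i) with hy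
  have hu (i) : c i * logAbove l N (f i) (x i) ≤ c i * (α - l * ‖x i‖) :=
    mul_le_mul_of_nonneg_left (logAbove_le (by linarith) (hf i _)) (hc i).le
  have hw (j) : d j * (-e - ‖y j‖) ≤ d j * Real.log (cutoff e N (g j) (y j)) :=
    mul_le_mul_of_nonneg_left (neg_le_log_cutoff (by linarith) _) (hd j).le
  have hu1 : ∑ i, c i * (α - l * ‖x i‖) = α * ∑ i, c i - l * ∑ i, c i * ‖x i‖ := by
    rw [Finset.mul_sum, Finset.mul_sum, ← Finset.sum_sub_distrib]
    exact Finset.sum_congr rfl fun i _ => by ring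
  have hw1 : ∑ j, d j * (-e - ‖y j‖) = -(e * ∑ j, d j) - ∑ j, d j * ‖y j‖ := by
    rw [Finset.mul_sum, ← Finset.sum_neg_distrib, ← Finset.sum_sub_distrib]
    exact Finset.sum_congr rfl fun i _ => by ring
  have hlx := hl x
  have hus := Finset.sum_le_sum fun i (_ : i ∈ Finset.univ) => hu i
  have hws := Finset.sum_le_sum fun j (_ : j ∈ Finset.univ) => hw j
  by_cases h1 : ∀ i, 0 < f i (x i) ∧ logAbove l N (f i) (x i) = Real.log (f i (x i))
  · by_cases h2 : ∀ j, (g j (y j) : ℝ) ≤ cutoff e N (g j) (y j)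
    · simp only [(h1 _).2]
      exact h.sum_mul_log_le hd (fun i => (h1 i).1) h2
    · push Not at h2
      obtain ⟨j, hj⟩ := h2
      have hj' : N ≤ Real.log (cutoff e N (g j) (y j)) :=
        (le_log_cutoff e N (g j) (y j)).resolve_right hj.not_ge
      have h3 : ∑ j', d j' * (-e - ‖y j'‖) - d j * (-e - ‖y j‖) + d j * N ≤
          ∑ j', d j' * Real.log (cutoff e N (g j') (y j')) := by
        rw [← Finset.sum_erase_add _ _ (Finset.mem_univ j),
          ← Finset.sum_erase_add _ (fun j' => d j' * Real.log _) (Finset.mem_univ j),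
          add_sub_cancel_right]
        exact add_le_add (Finset.sum_le_sum fun j _ => hw j)
          (mul_le_mul_of_nonneg_left hj' (hd j).le)
      have h4 : 0 ≤ d j * (e + ‖y j‖) := mul_nonneg (hd j).le (by positivity)
      linarith [hdN j]
  · push Not at h1
    obtain ⟨i, hi⟩ := h1
    have hi' : logAbove l N (f i) (x i) = -N - l * ‖x i‖ :=
      (logAbove_eq l N (f i) (x i)).resolve_right fun h => hi h.1 h.2
    have h3 : ∑ i', c i' * logAbove l N (f i') (x i') ≤
        ∑ i', c i' * (α - l * ‖x i'‖) - c i * (α - l * ‖x i‖) + c i * (-N - l * ‖x i‖) := by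
      rw [← Finset.sum_erase_add _ _ (Finset.mem_univ i),
        ← Finset.sum_erase_add _ (fun i' => c i' * (α - l * ‖x i'‖)) (Finset.mem_univ i),
        add_sub_cancel_right, hi']
      exact add_le_add_left (Finset.sum_le_sum fun i' _ => hu i') _
    have h4 : 0 ≤ c i * α := mul_nonneg (hc i).le hα
    linarith [hcN i]

end FRBL

namespace FRBL

lemma surjective_of_norm_adjoint {H G : Type*} [NormedAddCommGroup H] [InnerProductSpace ℝ H]
    [FiniteDimensional ℝ H] [NormedAddCommGroup G] [InnerProductSpace ℝ G]
    [FiniteDimensional ℝ G] {T : H →ₗ[ℝ] G} (hT : ∀ t, ‖adjoint T t‖ = ‖t‖) :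
    Function.Surjective T := by
  have h1 : LinearMap.ker (adjoint T) = ⊥ := by
    rw [LinearMap.ker_eq_bot']
    intro t ht
    rw [← norm_eq_zero, ← hT, ht, norm_zero]
  have h2 := LinearMap.orthogonal_ker (adjoint T)
  rw [h1, Submodule.bot_orthogonal_eq_top, LinearMap.adjoint_adjoint] at h2
  exact LinearMap.range_eq_top.1 h2.symm

section

variable {G : Type*} [NormedAddCommGroup G] [MeasurableSpace G] [BorelSpace G]

/-- The function `f`, truncated at height `n` and to the ball of radius `n`. -/
def trunc (n : ℕ) (f : G → ℝ≥0) : G → ℝ≥0 :=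
  (Metric.closedBall 0 n).indicator fun x => min (f x) n

lemma trunc_le (n : ℕ) (f : G → ℝ≥0) (x : G) : trunc n f x ≤ f x :=
  Set.indicator_le_self' (fun _ _ => zero_le) x |>.trans (min_le_left _ _)

lemma measurable_trunc (n : ℕ) {f : G → ℝ≥0} (hf : Measurable f) : Measurable (trunc n f) :=
  Measurable.indicator (by fun_prop) Metric.isClosed_closedBall.measurableSet

lemma trunc_le_exp (n : ℕ) (f : G → ℝ≥0) {l : ℝ} (hl : 0 ≤ l) (x : G) :
    trunc n f x ≤ Real.exp ((n + l * n) - l * ‖x‖) := by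
  by_cases hx : x ∈ Metric.closedBall (0 : G) n
  · rw [trunc, Set.indicator_of_mem hx]
    rw [mem_closedBall_zero_iff] at hx
    calc ((min (f x) n : ℝ≥0) : ℝ) ≤ n := by exact_mod_cast min_le_right _ _
      _ ≤ Real.exp n := by linarith [Real.add_one_le_exp (n : ℝ)]
      _ ≤ _ := Real.exp_le_exp.2 (by nlinarith)
  · rw [trunc, Set.indicator_of_notMem hx]
    exact_mod_cast (Real.exp_pos _).le

lemma lintegral_le_liminf_trunc {f : G → ℝ≥0} (hf : Measurable f) (μ : Measure G) :
    ∫⁻ x, (f x : ℝ≥0∞) ∂μ ≤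
      Filter.liminf (fun n => ∫⁻ x, (trunc n f x : ℝ≥0∞) ∂μ) Filter.atTop := by
  refine le_trans (le_of_eq (lintegral_congr fun x => ?_))
    (lintegral_liminf_le fun n => (measurable_trunc n hf).coe_nnreal_ennreal)
  refine (Filter.Tendsto.liminf_eq (tendsto_const_nhds.congr' ?_)).symm
  obtain ⟨n₀, hn₀⟩ := exists_nat_ge (max ‖x‖ (f x))
  filter_upwards [Filter.eventually_ge_atTop n₀] with n hn
  have hn' : (n₀ : ℝ) ≤ n := by exact_mod_cast hn
  have h1 : x ∈ Metric.closedBall (0 : G) n :=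
    mem_closedBall_zero_iff.2 ((le_max_left _ _).trans (hn₀.trans hn'))
  rw [trunc, Set.indicator_of_mem h1, min_eq_left]
  have := (le_max_right _ _).trans (hn₀.trans hn')
  exact_mod_cast this

end

variable {k m : ℕ}
  {E : Fin k → Type*} {F : Fin m → Type*}
  [∀ i, NormedAddCommGroup (E i)] [∀ i, InnerProductSpace ℝ (E i)]
  [∀ i, FiniteDimensional ℝ (E i)]
  [∀ i, MeasurableSpace (E i)] [∀ i, BorelSpace (E i)]
  [∀ j, NormedAddCommGroup (F j)] [∀ j, InnerProductSpace ℝ (F j)]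
  [∀ j, FiniteDimensional ℝ (F j)]
  [∀ j, MeasurableSpace (F j)] [∀ j, BorelSpace (F j)]
  {c : Fin k → ℝ} {d : Fin m → ℝ} {B : ∀ i j, E i →ₗ[ℝ] F j}
  {H : Type*} [NormedAddCommGroup H] [InnerProductSpace ℝ H] [FiniteDimensional ℝ H]
  {A : ∀ i, H →ₗ[ℝ] E i}

lemma exists_sum_norm_le (B : ∀ i j, E i →ₗ[ℝ] F j) (hc : ∀ i, 0 < c i) (hd : ∀ j, 0 < d j) :
    ∃ l, 0 ≤ l ∧ ∀ x : ∀ i, E i,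
      ∑ j, d j * ‖∑ i, c i • B i j (x i)‖ ≤ l * ∑ i, c i * ‖x i‖ := by
  set K : Fin k → Fin m → ℝ := fun i j => ‖LinearMap.toContinuousLinearMap (B i j)‖ with hK
  have hK0 (i j) : 0 ≤ K i j := norm_nonneg _
  refine ⟨∑ j, d j * ∑ i, K i j, Finset.sum_nonneg fun j _ => mul_nonneg (hd j).le
    (Finset.sum_nonneg fun i _ => hK0 i j), fun x => ?_⟩
  rw [Finset.sum_mul]
  refine Finset.sum_le_sum fun j _ => ?_
  rw [mul_assoc]
  refine mul_le_mul_of_nonneg_left ?_ (hd j).le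
  refine (norm_sum_le _ _).trans ?_
  rw [Finset.mul_sum]
  refine Finset.sum_le_sum fun i _ => ?_
  have h1 : ‖B i j (x i)‖ ≤ K i j * ‖x i‖ := (LinearMap.toContinuousLinearMap (B i j)).le_opNorm _
  have h2 : K i j ≤ ∑ i, K i j :=
    Finset.single_le_sum (f := fun i => K i j) (fun i _ => hK0 i j) (Finset.mem_univ i)
  rw [norm_smul, Real.norm_of_nonneg (hc i).le, mul_left_comm]
  refine mul_le_mul_of_nonneg_left (h1.trans ?_) (hc i).le
  gcongr

lemma GaussCoupling.prod_lintegral_le_of_exp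
    (hA : GaussCoupling E F c B A) (hc : ∀ i, 0 < c i) (hd : ∀ j, 0 < d j)
    (hG : ∀ x : ∀ i, E i, ∑ j, d j * ‖∑ i, c i • B i j (x i)‖ ^ 2 ≤ ∑ i, c i * ‖x i‖ ^ 2)
    (hsc : ScalingCond E F c d) {f : ∀ i, E i → ℝ≥0} {g : ∀ j, F j → ℝ≥0}
    (hfm : ∀ i, Measurable (f i)) (hgm : ∀ j, Measurable (g j)) (h : Hyp E F c d B f g)
    {l α : ℝ} (hl0 : 0 ≤ l) (hα : 0 ≤ α)
    (hl : ∀ x : ∀ i, E i, ∑ j, d j * ‖∑ i, c i • B i j (x i)‖ ≤ l * ∑ i, c i * ‖x i‖)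
    (hf : ∀ i x, f i x ≤ Real.exp (α - l * ‖x‖)) (hg : ∀ j, ∫⁻ y, (g j y : ℝ≥0∞) ≠ ∞) :
    ∏ i, (∫⁻ x, (f i x : ℝ≥0∞)) ^ c i ≤ ∏ j, (∫⁻ y, (g j y : ℝ≥0∞)) ^ d j := by
  set I : Fin m → ℝ≥0∞ := fun j => ∫⁻ y : F j, ENNReal.ofReal (Real.exp (-‖y‖)) with hI
  have hI0 (j) : I j ≠ ∞ := lintegral_exp_neg_norm_ne_top
  have step (n : ℕ) : ∏ i, (∫⁻ x, (f i x : ℝ≥0∞)) ^ c i ≤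
      ∏ j, ((∫⁻ y, (g j y : ℝ≥0∞)) + ENNReal.ofReal (Real.exp (-(n : ℝ))) * I j) ^ d j := by
    set S : ℝ := α * ∑ i, c i + n * ∑ j, d j with hS
    have hc' := Finset.sum_nonneg fun i (_ : i ∈ Finset.univ) => (hc i).le
    have hd' := Finset.sum_nonneg fun j (_ : j ∈ Finset.univ) => (hd j).le
    have hS0 : 0 ≤ S := by positivity
    set N : ℝ := ∑ i, S / c i + ∑ j, S / d j with hN
    have hN1 : 0 ≤ ∑ i, S / c i := Finset.sum_nonneg fun i _ => div_nonneg hS0 (hc i).le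
    have hN2 : 0 ≤ ∑ j, S / d j := Finset.sum_nonneg fun j _ => div_nonneg hS0 (hd j).le
    have hcN (i) : S ≤ c i * N := by
      rw [mul_comm, ← div_le_iff₀ (hc i)]
      have := Finset.single_le_sum (f := fun i => S / c i)
        (fun i _ => div_nonneg hS0 (hc i).le) (Finset.mem_univ i)
      linarith
    have hdN (j) : S ≤ d j * N := by
      rw [mul_comm, ← div_le_iff₀ (hd j)]
      have := Finset.single_le_sum (f := fun j => S / d j)
        (fun j _ => div_nonneg hS0 (hd j).le) (Finset.mem_univ j)
      linarith
    have hN0 : 0 ≤ N := add_nonneg hN1 hN2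
    have hn : -(n : ℝ) ≤ N := by linarith [(Nat.cast_nonneg n : (0 : ℝ) ≤ n)]
    have key := hA.prod_lintegral_exp_le hc hd hG hsc hl0 (add_nonneg hα hN0)
      (fun i => coarseLip_logAbove hl0 (by linarith : -N ≤ α) (hfm i) (hf i))
      (fun j => expBdd_cutoff hn (hgm j))
      (h.sum_mul_logAbove_le hc hd hα (Nat.cast_nonneg n) hN0 hl hf hS hcN hdN)
    refine le_trans (Finset.prod_le_prod' fun i _ => ENNReal.rpow_le_rpow
      (lintegral_mono fun x => ?_) (hc i).le) (key.trans (Finset.prod_le_prod' fun j _ =>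
        ENNReal.rpow_le_rpow (lintegral_cutoff_le (hgm j)) (hd j).le))
    rw [← ENNReal.ofReal_coe_nnreal]
    exact ENNReal.ofReal_le_ofReal (le_exp_logAbove x)
  refine ge_of_tendsto' (x := Filter.atTop)
    (ENNReal.tendsto_finsetProd_of_ne_top _ (fun j _ => ?_) fun j _ =>
    ENNReal.rpow_ne_top_of_nonneg (hd j).le (hg j)) step
  refine ((ENNReal.continuous_rpow_const (y := d j)).tendsto _).comp ?_
  have h1 : Filter.Tendsto (fun n : ℕ => ENNReal.ofReal (Real.exp (-(n : ℝ)))) Filter.atTop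
      (nhds 0) := by
    rw [← ENNReal.ofReal_zero]
    exact ENNReal.tendsto_ofReal (Real.tendsto_exp_neg_atTop_nhds_zero.comp
      tendsto_natCast_atTop_atTop)
  have h2 := (ENNReal.Tendsto.mul_const h1 (Or.inr (hI0 j))).const_add (∫⁻ y, (g j y : ℝ≥0∞))
  simpa using h2

lemma GaussCoupling.exists_lintegral_eq_zero (hA : GaussCoupling E F c B A) (hc : ∀ i, 0 < c i)
    (hd : ∀ j, 0 < d j)
    {f : ∀ i, E i → ℝ≥0} {g : ∀ j, F j → ℝ≥0}
    (hfm : ∀ i, Measurable (f i)) (hgm : ∀ j, Measurable (g j)) (h : Hyp E F c d B f g)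
    {j : Fin m} (hj : ∫⁻ y, (g j y : ℝ≥0∞) = 0) : ∃ i, ∫⁻ x, (f i x : ℝ≥0∞) = 0 := by
  set T : (∀ i, E i) →ₗ[ℝ] F j := ∑ i, c i • B i j ∘ₗ LinearMap.proj i with hT
  have hTx (x : ∀ i, E i) : T x = ∑ i, c i • B i j (x i) := by simp [hT]
  have hTs : Function.Surjective T := fun y => by
    obtain ⟨ξ, hξ⟩ := surjective_of_norm_adjoint (hA.2 j) y
    exact ⟨fun i => A i ξ, by rw [hTx, ← hξ]; simp⟩
  have h0 : ∀ᵐ y, y ∈ {y | g j y = 0} := by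
    rw [lintegral_eq_zero_iff (hgm j).coe_nnreal_ennreal] at hj
    filter_upwards [hj] with y hy
    simpa using hy
  have h1 := (ae_comp_linearMap_mem_iff T (volume : Measure (∀ i, E i)) volume hTs
    (hgm j (measurableSet_singleton 0))).2 h0
  have h2 : volume (Set.univ.pi fun i => {x | f i x ≠ 0}) = 0 := by
    refine measure_mono_null (fun x hx => ?_) (ae_iff.1 h1)
    intro hx'
    have h3 := h x
    rw [Finset.prod_eq_zero (Finset.mem_univ j), nonpos_iff_eq_zero, Finset.prod_eq_zero_iff] at h3
    · obtain ⟨i, -, hi⟩ := h3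
      exact hx i (Set.mem_univ i) ((NNReal.rpow_eq_zero (hc i).ne').1 hi)
    · rw [← hTx, show g j (T x) = 0 from hx', NNReal.zero_rpow (hd j).ne']
  rw [volume_pi, Measure.pi_pi, Finset.prod_eq_zero_iff] at h2
  obtain ⟨i, -, hi⟩ := h2
  refine ⟨i, (lintegral_eq_zero_iff (hfm i).coe_nnreal_ennreal).2 ?_⟩
  have h4 : ∀ᵐ x, f i x = 0 := ae_iff.2 hi
  filter_upwards [h4] with x hx
  simpa using hx

theorem GaussCoupling.prod_lintegral_coe_le
    (hA : GaussCoupling E F c B A) (hc : ∀ i, 0 < c i) (hd : ∀ j, 0 < d j)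
    (hG : ∀ x : ∀ i, E i, ∑ j, d j * ‖∑ i, c i • B i j (x i)‖ ^ 2 ≤ ∑ i, c i * ‖x i‖ ^ 2)
    (hsc : ScalingCond E F c d) {f : ∀ i, E i → ℝ≥0} {g : ∀ j, F j → ℝ≥0}
    (hfm : ∀ i, Measurable (f i)) (hgm : ∀ j, Measurable (g j)) (h : Hyp E F c d B f g) :
    ∏ i, (∫⁻ x, (f i x : ℝ≥0∞)) ^ c i ≤ ∏ j, (∫⁻ y, (g j y : ℝ≥0∞)) ^ d j := by
  by_cases h0 : ∃ j, ∫⁻ y, (g j y : ℝ≥0∞) = 0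
  · obtain ⟨j, hj⟩ := h0
    obtain ⟨i, hi⟩ := hA.exists_lintegral_eq_zero hc hd hfm hgm h hj
    rw [Finset.prod_eq_zero (Finset.mem_univ i) (by rw [hi, ENNReal.zero_rpow_of_pos (hc i)])]
    exact zero_le
  push Not at h0
  by_cases htop : ∃ j, ∫⁻ y, (g j y : ℝ≥0∞) = ∞
  · obtain ⟨j, hj⟩ := htop
    refine le_top.trans_eq (Eq.symm (WithTop.prod_eq_top (Finset.mem_univ j) ?_ fun j _ => ?_))
    · rw [hj]
      exact ENNReal.top_rpow_of_pos (hd j)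
    · intro h
      rcases ENNReal.rpow_eq_zero_iff.1 h with h | h
      · exact h0 j h.1
      · exact (hd j).not_gt h.2
  push Not at htop
  obtain ⟨l, hl0, hl⟩ := exists_sum_norm_le B hc hd
  refine prod_rpow_le_of_le_liminf hc (fun i => lintegral_le_liminf_trunc (hfm i) volume)
    (Filter.Eventually.of_forall fun n => ?_)
  refine hA.prod_lintegral_le_of_exp hc hd hG hsc (fun i => measurable_trunc n (hfm i)) hgm
    (fun x => le_trans (Finset.prod_le_prod' fun i _ => ?_) (h x)) hl0
    (by positivity : (0 : ℝ) ≤ n + l * n) hl (fun i => trunc_le_exp n (f i) hl0) htop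
  exact NNReal.rpow_le_rpow (trunc_le n (f i) _) (hc i).le

end FRBL

namespace FRBL

section

open InnerProductSpace

variable {X : Type*} [NormedAddCommGroup X] [InnerProductSpace ℝ X] [FiniteDimensional ℝ X]

lemma trace_sum_rankOne {p : ℕ} (u : Fin p → X) :
    LinearMap.trace ℝ X (∑ q, rankOne ℝ (u q) (u q) : X →L[ℝ] X) = ∑ q, ‖u q‖ ^ 2 := by
  rw [ContinuousLinearMap.toLinearMap_sum, map_sum]
  simp [InnerProductSpace.trace_rankOne]

lemma isCompact_isPositive_trace_eq (n : ℝ) :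
    IsCompact {S : X →L[ℝ] X | S.IsPositive ∧ LinearMap.trace ℝ X S = n} := by
  refine Metric.isCompact_of_isClosed_isBounded ?_ ?_
  · have h : {S : X →L[ℝ] X | S.IsPositive ∧ LinearMap.trace ℝ X S = n}
        = (⋂ x : X, ⋂ y : X, {S : X →L[ℝ] X | ⟪S x, y⟫ = ⟪x, S y⟫}) ∩
          ((⋂ x : X, {S : X →L[ℝ] X | 0 ≤ ⟪S x, x⟫}) ∩
            {S : X →L[ℝ] X | LinearMap.trace ℝ X S = n}) := by
      ext S
      simp only [Set.mem_ofPred_eq, Set.mem_inter_iff, Set.mem_iInter,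
        ContinuousLinearMap.isPositive_iff, LinearMap.IsSymmetric, and_assoc]
      rfl
    rw [h]
    refine (isClosed_iInter fun x => isClosed_iInter fun y => isClosed_eq ?_ ?_).inter
      ((isClosed_iInter fun x => isClosed_le ?_ ?_).inter (isClosed_eq ?_ ?_))
    any_goals fun_prop
    exact LinearMap.continuous_of_finiteDimensional
      ((LinearMap.trace ℝ X) ∘ₗ ContinuousLinearMap.coeLM ℝ)
  · refine isBounded_iff_forall_norm_le.2 ⟨n, ?_⟩
    rintro S ⟨hS, rfl⟩
    obtain ⟨p, u, rfl⟩ := ContinuousLinearMap.isPositive_iff_eq_sum_rankOne.1 hS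
    rw [trace_sum_rankOne]
    refine (norm_sum_le _ _).trans (Finset.sum_le_sum fun q _ => ?_)
    rw [norm_rankOne, sq]

/-- Dual characterization of the image of the positive operators of trace `n`. -/
lemma exists_sum_rankOne_eq {W : Type*} [NormedAddCommGroup W] [NormedSpace ℝ W]
    (Φ : (X →L[ℝ] X) →L[ℝ] W) (τ : W) {n : ℝ} (hn : 0 < n)
    (h : ∀ (l : W →L[ℝ] ℝ) (u : ℝ), (∀ x, l (Φ (rankOne ℝ x x)) ≤ u * ‖x‖ ^ 2) → l τ ≤ n * u) :
    ∃ (p : ℕ) (x : Fin p → X), ∑ q, Φ (rankOne ℝ (x q) (x q)) = τ := by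
  set s := {S : X →L[ℝ] X | S.IsPositive ∧ LinearMap.trace ℝ X S = n}
  by_cases hτ : τ ∈ Φ '' s
  · obtain ⟨S, ⟨hS, -⟩, rfl⟩ := hτ
    obtain ⟨p, u, rfl⟩ := ContinuousLinearMap.isPositive_iff_eq_sum_rankOne.1 hS
    exact ⟨p, u, by rw [map_sum]⟩
  · exfalso
    have hs : Convex ℝ s := by
      rintro S ⟨hS, hS'⟩ T ⟨hT, hT'⟩ a b ha hb hab
      refine ⟨(hS.smul_of_nonneg ha).add (hT.smul_of_nonneg hb), ?_⟩
      rw [ContinuousLinearMap.toLinearMap_add, ContinuousLinearMap.toLinearMap_smul,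
        ContinuousLinearMap.toLinearMap_smul, map_add, map_smul, map_smul, hS', hT']
      rw [← add_smul, hab, one_smul]
    have hcl : IsClosed (Φ '' s) :=
      ((isCompact_isPositive_trace_eq n).image Φ.continuous).isClosed
    obtain ⟨l, u, h1, h2⟩ := geometric_hahn_banach_closed_point
      (hs.linear_image Φ.toLinearMap) hcl hτ
    refine absurd (h l (u / n) fun x => ?_) (by rw [mul_div_cancel₀ _ hn.ne']; exact not_le.2 h2)
    rcases eq_or_ne x 0 with rfl | hx
    · simp
    have hx' : 0 < ‖x‖ ^ 2 := by positivity
    have := h1 (Φ ((n / ‖x‖ ^ 2) • rankOne ℝ x x)) ⟨_, ⟨?_, ?_⟩, rfl⟩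
    · rw [map_smul, map_smul, smul_eq_mul, div_mul_eq_mul_div, div_lt_iff₀ hx'] at this
      rw [div_mul_eq_mul_div, le_div_iff₀ hn]
      linarith
    · exact (isPositive_rankOne_self x).smul_of_nonneg (by positivity)
    · rw [ContinuousLinearMap.toLinearMap_smul, map_smul, InnerProductSpace.trace_rankOne,
        real_inner_self_eq_norm_sq, smul_eq_mul, div_mul_cancel₀ _ hx'.ne']

lemma exists_isSymmetric_of_dual (l : (X →L[ℝ] X) →L[ℝ] ℝ) :
    ∃ P : X →ₗ[ℝ] X, P.IsSymmetric ∧ (∀ z, ⟪P z, z⟫ = l (rankOne ℝ z z)) ∧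
      LinearMap.trace ℝ X P = l (ContinuousLinearMap.id ℝ X) := by
  set e := stdOrthonormalBasis ℝ X
  let Q : X →ₗ[ℝ] X :=
    { toFun := fun z => ∑ i, l (rankOne ℝ (e i) z) • e i
      map_add' := fun z w => by simp [add_smul, Finset.sum_add_distrib]
      map_smul' := fun a z => by simp [Finset.smul_sum, smul_smul] }
  have hQ : ∀ z w, ⟪Q z, w⟫ = l (rankOne ℝ w z) := by
    intro z w
    have : ∑ i, ⟪e i, w⟫ • e i = w := e.sum_repr' w
    conv_rhs => rw [← this]
    simp [Q, sum_inner, inner_smul_left, mul_comm]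
  have hP : ∀ z, ⟪((1 / 2 : ℝ) • (Q + adjoint Q)) z, z⟫ = l (rankOne ℝ z z) := by
    intro z
    rw [LinearMap.smul_apply, LinearMap.add_apply, inner_smul_left, inner_add_left,
      adjoint_inner_left, real_inner_comm (Q z) z, hQ]
    simp only [conj_trivial]
    ring
  refine ⟨(1 / 2 : ℝ) • (Q + adjoint Q), ?_, hP, ?_⟩
  · intro z w
    simp only [LinearMap.smul_apply, LinearMap.add_apply, inner_smul_left, inner_smul_right,
      inner_add_left, inner_add_right, adjoint_inner_left, adjoint_inner_right, conj_trivial]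
    ring
  · rw [LinearMap.trace_eq_sum_inner _ e, ← e.sum_rankOne_eq_id, map_sum]
    exact Finset.sum_congr rfl fun i _ => by rw [real_inner_comm, hP]

lemma hasDerivAt_log_det_one_add_smul (P : X →ₗ[ℝ] X) :
    HasDerivAt (fun t : ℝ => Real.log (LinearMap.det (LinearMap.id + t • P)))
      (LinearMap.trace ℝ X P) 0 := by
  set e := (stdOrthonormalBasis ℝ X).toBasis
  set M := LinearMap.toMatrix e e P
  have h1 : ∀ t : ℝ, LinearMap.det (LinearMap.id + t • P) =
      1 + M.trace * t + (Matrix.det (1 + (Polynomial.X : Polynomial ℝ) •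
        M.map Polynomial.C)).divX.divX.eval t * t ^ 2 := by
    intro t
    rw [← LinearMap.det_toMatrix e, ← Matrix.det_one_add_smul]
    congr 1
    rw [map_add, map_smul, LinearMap.toMatrix_id]
  have h2 : HasDerivAt (fun t : ℝ => LinearMap.det (LinearMap.id + t • P))
      (LinearMap.trace ℝ X P) 0 := by
    rw [funext h1]
    have := (((hasDerivAt_id (0 : ℝ)).const_mul M.trace).const_add 1).add
      (((Matrix.det (1 + (Polynomial.X : Polynomial ℝ) •
        M.map Polynomial.C)).divX.divX.hasDerivAt 0).mul ((hasDerivAt_id (0 : ℝ)).pow 2))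
    refine (this.congr_deriv ?_).congr_of_eventuallyEq (.of_forall fun t => ?_)
    · simp [M, LinearMap.trace_eq_matrix_trace ℝ e]
    · simp
  have := h2.log (by simp)
  simpa using this

end

end FRBL

namespace FRBL

section

variable {X : Type*} [NormedAddCommGroup X] [InnerProductSpace ℝ X] [FiniteDimensional ℝ X]

lemma posDef_id : PosDef (LinearMap.id : X →ₗ[ℝ] X) :=
  ⟨LinearMap.IsSymmetric.id, fun _ hx => real_inner_self_pos.2 hx⟩

lemma PosDef.smul {V : X →ₗ[ℝ] X} (hV : PosDef V) {s : ℝ} (hs : 0 < s) : PosDef (s • V) :=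
  ⟨hV.1.smul (by simp), fun x hx => by
    rw [LinearMap.smul_apply, real_inner_smul_left]; exact mul_pos hs (hV.2 x hx)⟩

lemma eventually_posDef_id_add_smul {P : X →ₗ[ℝ] X} (hP : P.IsSymmetric) :
    ∀ᶠ t in nhdsWithin (0 : ℝ) (Set.Ioi 0), PosDef (LinearMap.id + t • P) := by
  set C := ‖LinearMap.toContinuousLinearMap P‖
  have h : ∀ᶠ t in nhds (0 : ℝ), t * C < 1 := by
    have : Filter.Tendsto (fun t : ℝ => t * C) (nhds 0) (nhds (0 * C)) :=
      (continuous_mul_const C).tendsto 0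
    rw [zero_mul] at this
    exact this.eventually_lt_const one_pos
  filter_upwards [nhdsWithin_le_nhds h, self_mem_nhdsWithin] with t ht ht0
  refine ⟨LinearMap.IsSymmetric.id.add (hP.smul (by simp)), fun x hx => ?_⟩
  have h1 : -(C * ‖x‖ * ‖x‖) ≤ ⟪P x, x⟫ :=
    (abs_le.1 ((abs_real_inner_le_norm _ _).trans
      (mul_le_mul_of_nonneg_right ((LinearMap.toContinuousLinearMap P).le_opNorm x)
        (norm_nonneg _)))).1
  have h2 : 0 < ‖x‖ := norm_pos_iff.2 hx
  rw [LinearMap.add_apply, LinearMap.smul_apply, inner_add_left, real_inner_smul_left,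
    LinearMap.id_apply, real_inner_self_eq_norm_mul_norm]
  have h3 := mul_le_mul_of_nonneg_left h1 (le_of_lt ht0)
  have h4 : 0 < (1 - t * C) * (‖x‖ * ‖x‖) := by
    have : 0 < 1 - t * C := by linarith
    positivity
  linarith

/-- Conjugation `S ↦ T S T*`. -/
def conjCLM {Y : Type*} [NormedAddCommGroup Y] [InnerProductSpace ℝ Y] [FiniteDimensional ℝ Y]
    (T : X →L[ℝ] Y) : (X →L[ℝ] X) →L[ℝ] (Y →L[ℝ] Y) :=
  LinearMap.toContinuousLinearMap
    { toFun := fun S => T ∘L S ∘L ContinuousLinearMap.adjoint T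
      map_add' := fun S S' => by ext; simp
      map_smul' := fun a S => by ext; simp }

lemma conjCLM_rankOne {Y : Type*} [NormedAddCommGroup Y] [InnerProductSpace ℝ Y]
    [FiniteDimensional ℝ Y] (T : X →L[ℝ] Y) (x : X) :
    conjCLM T (InnerProductSpace.rankOne ℝ x x) = InnerProductSpace.rankOne ℝ (T x) (T x) := by
  change T ∘L InnerProductSpace.rankOne ℝ x x ∘L ContinuousLinearMap.adjoint T = _
  rw [InnerProductSpace.rankOne_comp, ContinuousLinearMap.adjoint_adjoint,
    InnerProductSpace.comp_rankOne]

lemma norm_adjoint_of_sum_rankOne_eq_id {p : ℕ} {L : EuclideanSpace ℝ (Fin p) →ₗ[ℝ] X}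
    (hL : ∑ q, InnerProductSpace.rankOne ℝ (L (EuclideanSpace.single q 1))
      (L (EuclideanSpace.single q 1)) = ContinuousLinearMap.id ℝ X) (t : X) :
    ‖adjoint L t‖ = ‖t‖ := by
  rw [← sq_eq_sq₀ (norm_nonneg _) (norm_nonneg _),
    ← (EuclideanSpace.basisFun (Fin p) ℝ).sum_sq_norm_inner_right]
  have h := congrArg (fun S : X →L[ℝ] X => ⟪S t, t⟫) hL
  simp only [ContinuousLinearMap.id_apply, real_inner_self_eq_norm_sq] at h
  rw [← h]
  simp [sum_inner, real_inner_smul_left,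
    LinearMap.adjoint_inner_right, sq]

end

variable {k m : ℕ}
  {E : Fin k → Type*} {F : Fin m → Type*}
  [∀ i, NormedAddCommGroup (E i)] [∀ i, InnerProductSpace ℝ (E i)]
  [∀ i, FiniteDimensional ℝ (E i)]
  [∀ j, NormedAddCommGroup (F j)] [∀ j, InnerProductSpace ℝ (F j)]
  [∀ j, FiniteDimensional ℝ (F j)]
  {c : Fin k → ℝ} {d : Fin m → ℝ} {B : ∀ i j, E i →ₗ[ℝ] F j}

lemma scalingCond_of_forall_le
    (hG : GaussCon E F c d B (fun _ => LinearMap.id) (fun _ => LinearMap.id))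
    (hmax : ∀ (V : ∀ i, E i →ₗ[ℝ] E i) (U : ∀ j, F j →ₗ[ℝ] F j), (∀ i, PosDef (V i)) →
      (∀ j, PosDef (U j)) → GaussCon E F c d B V U →
      ∑ j, d j * Real.log (LinearMap.det (U j)) ≤ ∑ i, c i * Real.log (LinearMap.det (V i))) :
    ScalingCond E F c d := by
  have key : ∀ r : ℝ, (∑ j, d j * (Module.finrank ℝ (F j) : ℝ)) * r ≤
      (∑ i, c i * (Module.finrank ℝ (E i) : ℝ)) * r := by
    intro r
    have := hmax (fun _ => Real.exp r • LinearMap.id) (fun _ => Real.exp r • LinearMap.id)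
      (fun _ => posDef_id.smul (Real.exp_pos r)) (fun _ => posDef_id.smul (Real.exp_pos r)) ?_
    · simpa [Finset.sum_mul, mul_assoc] using this
    · intro x
      have := mul_le_mul_of_nonneg_left (hG x) (Real.exp_pos r).le
      rw [Finset.mul_sum, Finset.mul_sum] at this
      simp only [LinearMap.smul_apply, real_inner_smul_left]
      simpa only [mul_left_comm (Real.exp r)] using this
  have h1 := key 1
  have h2 := key (-1)
  exact le_antisymm (by linarith) (by linarith)

lemma sum_trace_le_of_forall_le
    (hG : GaussCon E F c d B (fun _ => LinearMap.id) (fun _ => LinearMap.id))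
    (hmax : ∀ (V : ∀ i, E i →ₗ[ℝ] E i) (U : ∀ j, F j →ₗ[ℝ] F j), (∀ i, PosDef (V i)) →
      (∀ j, PosDef (U j)) → GaussCon E F c d B V U →
      ∑ j, d j * Real.log (LinearMap.det (U j)) ≤ ∑ i, c i * Real.log (LinearMap.det (V i)))
    {P : ∀ i, E i →ₗ[ℝ] E i} {Q : ∀ j, F j →ₗ[ℝ] F j} (hP : ∀ i, (P i).IsSymmetric)
    (hQ : ∀ j, (Q j).IsSymmetric) (hPQ : GaussCon E F c d B P Q) :
    ∑ j, d j * LinearMap.trace ℝ (F j) (Q j) ≤ ∑ i, c i * LinearMap.trace ℝ (E i) (P i) := by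
  set φ : ℝ → ℝ := fun t =>
    ∑ i, c i * Real.log (LinearMap.det (LinearMap.id + t • P i)) -
      ∑ j, d j * Real.log (LinearMap.det (LinearMap.id + t • Q j))
  have hφ : HasDerivAt φ (∑ i, c i * LinearMap.trace ℝ (E i) (P i) -
      ∑ j, d j * LinearMap.trace ℝ (F j) (Q j)) 0 :=
    (HasDerivAt.fun_sum fun i _ => (hasDerivAt_log_det_one_add_smul (P i)).const_mul (c i)).sub
      (HasDerivAt.fun_sum fun j _ => (hasDerivAt_log_det_one_add_smul (Q j)).const_mul (d j))
  rw [← sub_nonneg]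
  refine ge_of_tendsto hφ.tendsto_slope_zero_right ?_
  filter_upwards [Filter.eventually_all.2 fun i => eventually_posDef_id_add_smul (hP i),
    Filter.eventually_all.2 fun j => eventually_posDef_id_add_smul (hQ j),
    self_mem_nhdsWithin] with t h1 h2 ht
  have h0 : φ 0 = 0 := by simp [φ]
  rw [h0, sub_zero, zero_add, smul_eq_mul]
  refine mul_nonneg (inv_nonneg.2 (le_of_lt ht)) (sub_nonneg.2 (hmax _ _ h1 h2 fun x => ?_))
  have := mul_le_mul_of_nonneg_left (hPQ x) (le_of_lt ht)
  rw [Finset.mul_sum, Finset.mul_sum] at this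
  simp only [LinearMap.add_apply, LinearMap.smul_apply, inner_add_left, real_inner_smul_left,
    mul_add, Finset.sum_add_distrib]
  refine add_le_add (hG x) ?_
  simpa only [mul_left_comm t] using this

variable (E c B) in
/-- The map `B_j Λ_c` as a continuous linear map. -/
def BLamL (j : Fin m) : PiLp 2 E →L[ℝ] F j :=
  ∑ i, c i • LinearMap.toContinuousLinearMap (B i j) ∘L PiLp.proj 2 E i

lemma BLamL_apply (j : Fin m) (x : PiLp 2 E) : BLamL E c B j x = ∑ i, c i • B i j (x i) := by
  simp [BLamL]

theorem exists_gaussCoupling (hc : ∀ i, 0 < c i) (hd : ∀ j, 0 < d j)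
    (hG : GaussCon E F c d B (fun _ => LinearMap.id) (fun _ => LinearMap.id))
    (hmax : ∀ (V : ∀ i, E i →ₗ[ℝ] E i) (U : ∀ j, F j →ₗ[ℝ] F j), (∀ i, PosDef (V i)) →
      (∀ j, PosDef (U j)) → GaussCon E F c d B V U →
      ∑ j, d j * Real.log (LinearMap.det (U j)) ≤ ∑ i, c i * Real.log (LinearMap.det (V i))) :
    ∃ (p : ℕ) (A : ∀ i, EuclideanSpace ℝ (Fin p) →ₗ[ℝ] E i), GaussCoupling E F c B A := by
  have hsc := scalingCond_of_forall_le hG hmax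
  rcases Nat.eq_zero_or_pos (∑ i, Module.finrank ℝ (E i)) with h0 | hn
  · have hE : ∀ i, Module.finrank ℝ (E i) = 0 := by simpa using h0
    have hF : ∀ j, Module.finrank ℝ (F j) = 0 := by
      have h : ∑ j, d j * (Module.finrank ℝ (F j) : ℝ) = 0 := by
        rw [← hsc]; simp [hE]
      rw [Finset.sum_eq_zero_iff_of_nonneg
        (fun j _ => mul_nonneg (hd j).le (Nat.cast_nonneg _))] at h
      intro j
      simpa [(hd j).ne'] using h j (Finset.mem_univ j)
    refine ⟨0, fun i => 0, fun i t => ?_, fun j t => ?_⟩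
    · have := Module.finrank_zero_iff.1 (hE i)
      simp [Subsingleton.elim t 0]
    · have := Module.finrank_zero_iff.1 (hF j)
      simp [Subsingleton.elim t 0]
  · let Φ : (PiLp 2 E →L[ℝ] PiLp 2 E) →L[ℝ] (∀ i, E i →L[ℝ] E i) × (∀ j, F j →L[ℝ] F j) :=
      (ContinuousLinearMap.pi fun i => conjCLM (PiLp.proj 2 E i)).prod
        (ContinuousLinearMap.pi fun j => conjCLM (BLamL E c B j))
    have hdual : ∀ (l : (∀ i, E i →L[ℝ] E i) × (∀ j, F j →L[ℝ] F j) →L[ℝ] ℝ) (u : ℝ),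
        (∀ x, l (Φ (InnerProductSpace.rankOne ℝ x x)) ≤ u * ‖x‖ ^ 2) →
        l (fun i => ContinuousLinearMap.id ℝ (E i), fun j => ContinuousLinearMap.id ℝ (F j)) ≤
          ((∑ i, Module.finrank ℝ (E i) : ℕ) : ℝ) * u := by
      intro l u hl
      choose P hPs hP hPt using fun i => exists_isSymmetric_of_dual
        (l ∘L ContinuousLinearMap.inl ℝ _ _ ∘L
          ContinuousLinearMap.single ℝ (fun i => E i →L[ℝ] E i) i)
      choose Q hQs hQ hQt using fun j => exists_isSymmetric_of_dual
        (l ∘L ContinuousLinearMap.inr ℝ _ _ ∘L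
          ContinuousLinearMap.single ℝ (fun j => F j →L[ℝ] F j) j)
      have hdec : ∀ (a : ∀ i, E i →L[ℝ] E i) (b : ∀ j, F j →L[ℝ] F j), l (a, b) =
          ∑ i, (l ∘L ContinuousLinearMap.inl ℝ _ _ ∘L
            ContinuousLinearMap.single ℝ (fun i => E i →L[ℝ] E i) i) (a i) +
          ∑ j, (l ∘L ContinuousLinearMap.inr ℝ _ _ ∘L
            ContinuousLinearMap.single ℝ (fun j => F j →L[ℝ] F j) j) (b j) := by
        intro a b
        have h1 : (a, b) = ContinuousLinearMap.inl ℝ _ _ (∑ i, Pi.single i (a i)) +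
            ContinuousLinearMap.inr ℝ _ _ (∑ j, Pi.single j (b j)) := by
          rw [Finset.univ_sum_single, Finset.univ_sum_single]; simp
        rw [h1, map_add, map_sum, map_sum, map_sum, map_sum]
        rfl
      have key := sum_trace_le_of_forall_le hG hmax
        (P := fun i => (c i)⁻¹ • (u • LinearMap.id - P i)) (Q := fun j => (d j)⁻¹ • Q j)
        (fun i => ((LinearMap.IsSymmetric.id.smul (by simp)).sub (hPs i)).smul (by simp))
        (fun j => (hQs j).smul (by simp)) ?_
      · simp only [map_smul, map_sub, smul_eq_mul, LinearMap.trace_id,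
          mul_inv_cancel_left₀ (hc _).ne', mul_inv_cancel_left₀ (hd _).ne',
          Finset.sum_sub_distrib, ← Finset.mul_sum] at key
        rw [hdec, ← Finset.sum_congr rfl fun i _ => hPt i, ← Finset.sum_congr rfl fun j _ => hQt j]
        push_cast
        linarith
      · intro x
        have := hl (WithLp.toLp 2 x)
        have hΦ : Φ (InnerProductSpace.rankOne ℝ (WithLp.toLp 2 x) (WithLp.toLp 2 x)) =
            (fun i => InnerProductSpace.rankOne ℝ (x i) (x i),
              fun j => InnerProductSpace.rankOne ℝ (∑ i, c i • B i j (x i))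
                (∑ i, c i • B i j (x i))) := by
          refine Prod.ext (funext fun i => conjCLM_rankOne _ _) (funext fun j => ?_)
          refine (conjCLM_rankOne _ _).trans ?_
          rw [BLamL_apply]
        rw [hΦ, hdec, ← Finset.sum_congr rfl fun i _ => hP i _,
          ← Finset.sum_congr rfl fun j _ => hQ j _, PiLp.norm_sq_eq_of_L2, Finset.mul_sum] at this
        simp only [LinearMap.smul_apply, LinearMap.sub_apply, inner_sub_left,
          real_inner_smul_left, mul_inv_cancel_left₀ (hc _).ne', mul_inv_cancel_left₀ (hd _).ne',
          Finset.sum_sub_distrib, LinearMap.id_apply, real_inner_self_eq_norm_sq]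
        linarith
    obtain ⟨p, x, hx⟩ := exists_sum_rankOne_eq Φ
      (fun i => ContinuousLinearMap.id ℝ (E i), fun j => ContinuousLinearMap.id ℝ (F j))
      (by exact_mod_cast hn) hdual
    let M : EuclideanSpace ℝ (Fin p) →ₗ[ℝ] PiLp 2 E :=
      (EuclideanSpace.basisFun (Fin p) ℝ).toBasis.constr ℝ x
    have hM : ∀ q, M (EuclideanSpace.single q 1) = x q := fun q => by
      rw [← (EuclideanSpace.basisFun (Fin p) ℝ).toBasis.constr_basis ℝ x q]
      simp [M]
    have h1 := congrArg Prod.fst hx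
    have h2 := congrArg Prod.snd hx
    rw [Prod.fst_sum] at h1
    rw [Prod.snd_sum] at h2
    refine ⟨p, fun i => (PiLp.proj 2 E i).toLinearMap ∘ₗ M, fun i t => ?_, fun j t => ?_⟩
    · refine norm_adjoint_of_sum_rankOne_eq_id ?_ t
      have := congrFun h1 i
      rw [Finset.sum_apply] at this
      simp only [LinearMap.comp_apply, hM]
      refine Eq.trans ?_ this
      exact Finset.sum_congr rfl fun q _ => (conjCLM_rankOne _ _).symm
    · have hB : ∑ i, c i • B i j ∘ₗ (PiLp.proj 2 E i).toLinearMap ∘ₗ M =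
          (BLamL E c B j).toLinearMap ∘ₗ M := by
        ext q
        simp [BLamL_apply, LinearMap.sum_apply]
      rw [hB]
      refine norm_adjoint_of_sum_rankOne_eq_id ?_ t
      have := congrFun h2 j
      rw [Finset.sum_apply] at this
      simp only [LinearMap.comp_apply, hM]
      refine Eq.trans ?_ this
      exact Finset.sum_congr rfl fun q _ => (conjCLM_rankOne _ _).symm

end FRBL

namespace FRBL

section

variable {X : Type*} [NormedAddCommGroup X] [InnerProductSpace ℝ X] [FiniteDimensional ℝ X]

/-- A positive definite operator has a symmetric inverse square root. -/
lemma PosDef.exists_inv_sqrt {V : X →ₗ[ℝ] X} (hV : PosDef V) :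
    ∃ S : X ≃ₗ[ℝ] X, S.toLinearMap.IsSymmetric ∧ ∀ x, S (V (S x)) = x := by
  set b := hV.1.eigenvectorBasis rfl
  set v := hV.1.eigenvalues rfl
  have hb : ∀ i, V (b i) = v i • b i := fun i =>
    hV.1.apply_eigenvectorBasis rfl i
  have hv : ∀ i, 0 < v i := fun i => by
    have h := hV.2 (b i) (b.orthonormal.ne_zero i)
    rw [hb, real_inner_smul_left, real_inner_self_eq_norm_sq, b.orthonormal.1 i] at h
    simpa using h
  set R : X →L[ℝ] X := ∑ i, (Real.sqrt (v i))⁻¹ • InnerProductSpace.rankOne ℝ (b i) (b i)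
  have hR : R.IsPositive := ContinuousLinearMap.isPositive_sum _ fun i _ =>
    (InnerProductSpace.isPositive_rankOne_self _).smul_of_nonneg
      (inv_nonneg.2 (Real.sqrt_nonneg _))
  have hRb : ∀ i, R (b i) = (Real.sqrt (v i))⁻¹ • b i := fun i => by
    simp [R, orthonormal_iff_ite.1 b.orthonormal]
  have hRVR : ∀ x, R (V (R x)) = x := by
    have : R.toLinearMap ∘ₗ V ∘ₗ R.toLinearMap = LinearMap.id := by
      refine b.toBasis.ext fun i => ?_
      have h1 : Real.sqrt (v i) ≠ 0 := (Real.sqrt_pos.2 (hv i)).ne'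
      have h2 : (Real.sqrt (v i))⁻¹ * v i * (Real.sqrt (v i))⁻¹ = 1 := by
        field_simp
        exact (Real.sq_sqrt (hv i).le).symm
      simp [hRb, hb, smul_smul, h2]
    exact fun x => LinearMap.congr_fun this x
  have hinj : Function.Injective R.toLinearMap := fun x y hxy => by
    rw [← hRVR x, ← hRVR y]
    exact congrArg (fun z => R (V z)) hxy
  exact ⟨LinearEquiv.ofInjectiveEndo R.toLinearMap hinj, fun x y => hR.isSymmetric x y, hRVR⟩

variable {V : X →ₗ[ℝ] X} {S : X ≃ₗ[ℝ] X}

lemma apply_eq_symm_symm (hS : ∀ x, S (V (S x)) = x) (x : X) : V x = S.symm (S.symm x) := by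
  rw [LinearEquiv.eq_symm_apply]
  have := hS (S.symm x)
  rw [LinearEquiv.apply_symm_apply] at this
  rw [this]

lemma symm_isSymmetric (h : S.toLinearMap.IsSymmetric) : S.symm.toLinearMap.IsSymmetric :=
  fun x y => by
    have := h (S.symm x) (S.symm y)
    simpa using this.symm

lemma inner_apply_eq_norm_symm_sq (h : S.toLinearMap.IsSymmetric) (hS : ∀ x, S (V (S x)) = x)
    (x : X) : ⟪V x, x⟫ = ‖S.symm x‖ ^ 2 := by
  rw [apply_eq_symm_symm hS, ← real_inner_self_eq_norm_sq]
  exact symm_isSymmetric h (S.symm x) x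

lemma det_eq_sq_det_symm (hS : ∀ x, S (V (S x)) = x) :
    LinearMap.det V = LinearMap.det S.symm.toLinearMap ^ 2 := by
  have : V = S.symm.toLinearMap ∘ₗ S.symm.toLinearMap :=
    LinearMap.ext fun x => apply_eq_symm_symm hS x
  rw [this, LinearMap.det_comp, sq]

lemma det_symm_ne_zero (S : X ≃ₗ[ℝ] X) : LinearMap.det S.symm.toLinearMap ≠ 0 :=
  (LinearEquiv.isUnit_det' S.symm).ne_zero

lemma PosDef.det_pos (hV : PosDef V) : 0 < LinearMap.det V := by
  obtain ⟨S, -, hS⟩ := hV.exists_inv_sqrt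
  rw [det_eq_sq_det_symm hS]
  exact sq_pos_of_ne_zero (det_symm_ne_zero S)

lemma PosDef.conj {V' : X →ₗ[ℝ] X} (hV' : PosDef V') (h : S.toLinearMap.IsSymmetric) :
    PosDef (S.symm.toLinearMap ∘ₗ V' ∘ₗ S.symm.toLinearMap) := by
  have h' := symm_isSymmetric h
  refine ⟨fun x y => ?_, fun x hx => ?_⟩
  · exact (h' _ _).trans ((hV'.1 _ _).trans (h' _ _))
  · exact (hV'.2 (S.symm x) (by simpa using hx)).trans_eq (h' (V' (S.symm x)) x).symm

lemma log_det_conj {V' : X →ₗ[ℝ] X} (hV' : PosDef V') (hS : ∀ x, S (V (S x)) = x) :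
    Real.log (LinearMap.det (S.symm.toLinearMap ∘ₗ V' ∘ₗ S.symm.toLinearMap)) =
      Real.log (LinearMap.det V) + Real.log (LinearMap.det V') := by
  have h0 := det_symm_ne_zero S
  rw [LinearMap.det_comp, LinearMap.det_comp, mul_comm, mul_assoc, ← sq,
    ← det_eq_sq_det_symm hS, mul_comm, Real.log_mul _ hV'.det_pos.ne']
  rw [det_eq_sq_det_symm hS]
  exact pow_ne_zero 2 h0

variable [MeasurableSpace X] [BorelSpace X]

lemma lintegral_comp_inv_sqrt (hS : ∀ x, S (V (S x)) = x) {f : X → ℝ≥0∞} (hf : Measurable f) :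
    ∫⁻ x, f (S x) =
      ENNReal.ofReal (Real.exp (Real.log (LinearMap.det V) / 2)) * ∫⁻ x, f x := by
  have h0 : LinearMap.det S.toLinearMap ≠ 0 := (LinearEquiv.isUnit_det' S).ne_zero
  have hm : Measurable S.toLinearMap :=
    (LinearMap.continuous_of_finiteDimensional S.toLinearMap).measurable
  have h1 := Measure.map_linearMap_addHaar_eq_smul_addHaar (volume : Measure X) h0
  have h2 : (LinearMap.det S.toLinearMap)⁻¹ = LinearMap.det S.symm.toLinearMap := by
    refine inv_eq_of_mul_eq_one_right ?_
    rw [← LinearMap.det_comp]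
    simp
  have h3 : |(LinearMap.det S.toLinearMap)⁻¹| =
      Real.exp (Real.log (LinearMap.det V) / 2) := by
    rw [h2, det_eq_sq_det_symm hS, Real.log_pow, ← Real.exp_log (abs_pos.2 (det_symm_ne_zero S)),
      Real.log_abs]
    congr 1
    push_cast
    ring
  rw [h3] at h1
  have h4 := lintegral_map (μ := volume) hf hm
  rw [h1, lintegral_smul_measure] at h4
  exact h4.symm

lemma lintegral_exp_neg_pi_norm_sq :
    ∫⁻ x : X, ENNReal.ofReal (Real.exp (-Real.pi * ‖x‖ ^ 2)) = 1 := by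
  have h := GaussianFourier.integral_rexp_neg_mul_sq_norm (V := X) Real.pi_pos
  rw [div_self Real.pi_pos.ne', Real.one_rpow] at h
  have hi : Integrable fun x : X => Real.exp (-Real.pi * ‖x‖ ^ 2) := by
    by_contra hn
    rw [integral_undef hn] at h
    exact zero_ne_one h
  rw [← ofReal_integral_eq_lintegral_ofReal hi (.of_forall fun x => (Real.exp_pos _).le), h,
    ENNReal.ofReal_one]

lemma PosDef.lintegral_exp_neg_pi (hV : PosDef V) :
    ∫⁻ x : X, ENNReal.ofReal (Real.exp (-Real.pi * ⟪V x, x⟫)) =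
      ENNReal.ofReal (Real.exp (-(Real.log (LinearMap.det V) / 2))) := by
  obtain ⟨S, h, hS⟩ := hV.exists_inv_sqrt
  have hc : Continuous V := LinearMap.continuous_of_finiteDimensional V
  have h1 := lintegral_comp_inv_sqrt hS
    (f := fun x => ENNReal.ofReal (Real.exp (-Real.pi * ⟪V x, x⟫))) (by fun_prop)
  simp only [inner_apply_eq_norm_symm_sq h hS, LinearEquiv.symm_apply_apply] at h1 ⊢
  rw [lintegral_exp_neg_pi_norm_sq] at h1
  rw [Real.exp_neg, ENNReal.ofReal_inv_of_pos (Real.exp_pos _)]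
  exact ENNReal.eq_inv_of_mul_eq_one_left (by rw [mul_comm]; exact h1.symm)

end

lemma prod_ofReal_exp_mul_rpow {n : ℕ} {c : Fin n → ℝ} (hc : ∀ i, 0 < c i) (a : Fin n → ℝ)
    (I : Fin n → ℝ≥0∞) :
    ∏ i, (ENNReal.ofReal (Real.exp (a i)) * I i) ^ c i =
      ENNReal.ofReal (Real.exp (∑ i, c i * a i)) * ∏ i, I i ^ c i := by
  rw [Real.exp_sum, ENNReal.ofReal_prod_of_nonneg (fun i _ => (Real.exp_pos _).le),
    ← Finset.prod_mul_distrib]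
  refine Finset.prod_congr rfl fun i _ => ?_
  rw [ENNReal.mul_rpow_of_nonneg _ _ (hc i).le, ENNReal.ofReal_rpow_of_pos (Real.exp_pos _),
    ← Real.exp_mul, mul_comm (a i)]

variable {k m : ℕ}
  {E : Fin k → Type*} {F : Fin m → Type*}
  [∀ i, NormedAddCommGroup (E i)] [∀ i, InnerProductSpace ℝ (E i)]
  [∀ i, FiniteDimensional ℝ (E i)]
  [∀ i, MeasurableSpace (E i)] [∀ i, BorelSpace (E i)]
  [∀ j, NormedAddCommGroup (F j)] [∀ j, InnerProductSpace ℝ (F j)]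
  [∀ j, FiniteDimensional ℝ (F j)]
  [∀ j, MeasurableSpace (F j)] [∀ j, BorelSpace (F j)]
  {c : Fin k → ℝ} {d : Fin m → ℝ} {B : ∀ i j, E i →ₗ[ℝ] F j}

/-- Testing on gaussian functions. -/
lemma IsBound.gaussObj_le (hc : ∀ i, 0 < c i) (hd : ∀ j, 0 < d j) {D₀ : ℝ}
    (h : IsBound E F c d B D₀) {V : ∀ i, E i →ₗ[ℝ] E i} {U : ∀ j, F j →ₗ[ℝ] F j}
    (hV : ∀ i, PosDef (V i)) (hU : ∀ j, PosDef (U j)) (hVU : GaussCon E F c d B V U) :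
    gaussObj E F c d V U ≤ D₀ := by
  have hcV : ∀ i, Continuous (V i) := fun i => LinearMap.continuous_of_finiteDimensional _
  have hcU : ∀ j, Continuous (U j) := fun j => LinearMap.continuous_of_finiteDimensional _
  have key := h (fun i x => (Real.exp (-Real.pi * ⟪V i x, x⟫)).toNNReal)
    (fun j y => (Real.exp (-Real.pi * ⟪U j y, y⟫)).toNNReal)
    (fun i => by have := hcV i; fun_prop) (fun j => by have := hcU j; fun_prop) ?_
  · have hI : ∀ i, ∫⁻ x : E i, ((Real.exp (-Real.pi * ⟪V i x, x⟫)).toNNReal : ℝ≥0∞) =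
        ENNReal.ofReal (Real.exp (-(Real.log (LinearMap.det (V i)) / 2))) * 1 := fun i => by
      rw [mul_one]; exact (hV i).lintegral_exp_neg_pi
    have hJ : ∀ j, ∫⁻ x : F j, ((Real.exp (-Real.pi * ⟪U j x, x⟫)).toNNReal : ℝ≥0∞) =
        ENNReal.ofReal (Real.exp (-(Real.log (LinearMap.det (U j)) / 2))) * 1 := fun j => by
      rw [mul_one]; exact (hU j).lintegral_exp_neg_pi
    simp only [hI, hJ] at key
    rw [prod_ofReal_exp_mul_rpow hc, prod_ofReal_exp_mul_rpow hd] at key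
    simp only [ENNReal.one_rpow, Finset.prod_const_one, mul_one] at key
    rw [← ENNReal.ofReal_mul (Real.exp_pos _).le, ← Real.exp_add,
      ENNReal.ofReal_le_ofReal_iff (Real.exp_pos _).le, Real.exp_le_exp] at key
    simp only [mul_neg, Finset.sum_neg_distrib, mul_div_assoc', ← Finset.sum_div] at key
    rw [gaussObj]
    linarith
  · intro x
    rw [← NNReal.coe_le_coe, NNReal.coe_prod, NNReal.coe_prod]
    simp only [NNReal.coe_rpow, Real.coe_toNNReal _ (Real.exp_pos _).le, ← Real.exp_mul,
      ← Real.exp_sum]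
    rw [Real.exp_le_exp]
    have := mul_le_mul_of_nonneg_left (hVU x) Real.pi_pos.le
    rw [Finset.mul_sum, Finset.mul_sum] at this
    simp only [neg_mul, Finset.sum_neg_distrib, neg_le_neg_iff]
    simpa only [mul_assoc, mul_comm, mul_left_comm] using this

/-- Reduction of a gaussian-extremizable datum to the geometric case. -/
lemma isBound_gaussObj (hc : ∀ i, 0 < c i) (hd : ∀ j, 0 < d j)
    {V : ∀ i, E i →ₗ[ℝ] E i} {U : ∀ j, F j →ₗ[ℝ] F j}
    (hV : ∀ i, PosDef (V i)) (hU : ∀ j, PosDef (U j)) (hVU : GaussCon E F c d B V U)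
    (hmax : ∀ (V' : ∀ i, E i →ₗ[ℝ] E i) (U' : ∀ j, F j →ₗ[ℝ] F j), (∀ i, PosDef (V' i)) →
      (∀ j, PosDef (U' j)) → GaussCon E F c d B V' U' →
      gaussObj E F c d V' U' ≤ gaussObj E F c d V U) :
    IsBound E F c d B (gaussObj E F c d V U) := by
  choose S hSs hS using fun i => (hV i).exists_inv_sqrt
  choose T hTs hT using fun j => (hU j).exists_inv_sqrt
  set B' : ∀ i j, E i →ₗ[ℝ] F j := fun i j =>
    (T j).symm.toLinearMap ∘ₗ B i j ∘ₗ (S i).toLinearMap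
  have hB' : ∀ j (x : ∀ i, E i), ∑ i, c i • B' i j (x i) =
      (T j).symm (∑ i, c i • B i j (S i (x i))) := fun j x => by
    simp [B', map_sum]
  have hG : GaussCon E F c d B' (fun _ => LinearMap.id) (fun _ => LinearMap.id) := fun x => by
    have := hVU fun i => S i (x i)
    simp only [inner_apply_eq_norm_symm_sq (hSs _) (hS _),
      inner_apply_eq_norm_symm_sq (hTs _) (hT _), LinearEquiv.symm_apply_apply] at this
    simpa only [hB', LinearMap.id_apply, real_inner_self_eq_norm_sq] using this
  have hmax' : ∀ (V' : ∀ i, E i →ₗ[ℝ] E i) (U' : ∀ j, F j →ₗ[ℝ] F j), (∀ i, PosDef (V' i)) →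
      (∀ j, PosDef (U' j)) → GaussCon E F c d B' V' U' →
      ∑ j, d j * Real.log (LinearMap.det (U' j)) ≤
        ∑ i, c i * Real.log (LinearMap.det (V' i)) := by
    intro V' U' hV' hU' hVU'
    have := hmax (fun i => (S i).symm.toLinearMap ∘ₗ V' i ∘ₗ (S i).symm.toLinearMap)
      (fun j => (T j).symm.toLinearMap ∘ₗ U' j ∘ₗ (T j).symm.toLinearMap)
      (fun i => (hV' i).conj (hSs i)) (fun j => (hU' j).conj (hTs j)) ?_
    · simp only [gaussObj, log_det_conj (hV' _) (hS _), log_det_conj (hU' _) (hT _), mul_add,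
        Finset.sum_add_distrib] at this
      linarith
    · intro x
      have := hVU' fun i => (S i).symm (x i)
      simp only [hB', LinearEquiv.apply_symm_apply] at this
      have hs : ∀ i (z w : E i), ⟪(S i).symm z, w⟫ = ⟪z, (S i).symm w⟫ :=
        fun i => symm_isSymmetric (hSs i)
      have ht : ∀ j (z w : F j), ⟪(T j).symm z, w⟫ = ⟪z, (T j).symm w⟫ :=
        fun j => symm_isSymmetric (hTs j)
      simpa only [LinearMap.comp_apply, LinearEquiv.coe_coe, hs, ht] using this
  obtain ⟨p, A, hA⟩ := exists_gaussCoupling hc hd hG hmax'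
  intro f g hf hg hfg
  have hcS : ∀ i, Measurable (S i) := fun i =>
    (LinearMap.continuous_of_finiteDimensional (S i).toLinearMap).measurable
  have hcT : ∀ j, Measurable (T j) := fun j =>
    (LinearMap.continuous_of_finiteDimensional (T j).toLinearMap).measurable
  have key := hA.prod_lintegral_coe_le hc hd
    (fun x => by simpa only [LinearMap.id_apply, real_inner_self_eq_norm_sq] using hG x)
    (scalingCond_of_forall_le hG hmax')
    (f := fun i x => f i (S i x)) (g := fun j y => g j (T j y))
    (fun i => (hf i).comp (hcS i)) (fun j => (hg j).comp (hcT j))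
    (fun x => by simpa only [hB', LinearEquiv.apply_symm_apply] using hfg fun i => S i (x i))
  have hI : ∀ i, ∫⁻ x, (f i (S i x) : ℝ≥0∞) = _ := fun i =>
    lintegral_comp_inv_sqrt (hS i) (f := fun x => (f i x : ℝ≥0∞)) (hf i).coe_nnreal_ennreal
  have hJ : ∀ j, ∫⁻ y, (g j (T j y) : ℝ≥0∞) = _ := fun j =>
    lintegral_comp_inv_sqrt (hT j) (f := fun y => (g j y : ℝ≥0∞)) (hg j).coe_nnreal_ennreal
  simp only [hI, hJ, prod_ofReal_exp_mul_rpow hc, prod_ofReal_exp_mul_rpow hd] at key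
  set a := ∑ i, c i * (Real.log (LinearMap.det (V i)) / 2) with ha
  set b := ∑ j, d j * (Real.log (LinearMap.det (U j)) / 2) with hb
  have hab : gaussObj E F c d V U = -a + b := by
    rw [gaussObj, ha, hb]
    simp only [mul_div_assoc', ← Finset.sum_div]
    ring
  have hone : ENNReal.ofReal (Real.exp (-a)) * ENNReal.ofReal (Real.exp a) = 1 := by
    rw [← ENNReal.ofReal_mul (Real.exp_pos _).le, ← Real.exp_add]
    simp
  have := mul_le_mul_right key (ENNReal.ofReal (Real.exp (-a)))
  rw [← mul_assoc, ← mul_assoc, hone, one_mul, ← ENNReal.ofReal_mul (Real.exp_pos _).le,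
    ← Real.exp_add] at this
  rwa [hab]

end FRBL

namespace FRBL

variable {k m : ℕ}
  (E : Fin k → Type*) (F : Fin m → Type*)
  [∀ i, NormedAddCommGroup (E i)] [∀ i, InnerProductSpace ℝ (E i)]
  [∀ i, FiniteDimensional ℝ (E i)]
  [∀ i, MeasurableSpace (E i)] [∀ i, BorelSpace (E i)]
  [∀ j, NormedAddCommGroup (F j)] [∀ j, InnerProductSpace ℝ (F j)]
  [∀ j, FiniteDimensional ℝ (F j)]
  [∀ j, MeasurableSpace (F j)] [∀ j, BorelSpace (F j)]

/-- **Theorem.** If a datum `(c,d,B)` is gaussian-extremizable, then `D(c,d,B) = D_g(c,d,B)`. -/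
theorem D_eq_Dg_of_gaussExt
    (c : Fin k → ℝ) (d : Fin m → ℝ) (B : ∀ i j, E i →ₗ[ℝ] F j)
    (hc : ∀ i, 0 < c i) (hd : ∀ j, 0 < d j)
    (hext : GaussExt E F c d B) :
    D E F c d B = Dg E F c d B := by
  obtain ⟨V, U, hV, hU, hVU, hDg⟩ := hext
  refine le_antisymm ?_ (le_sInf ?_)
  · rw [hDg]
    refine sInf_le ⟨_, rfl, isBound_gaussObj hc hd hV hU hVU fun V' U' hV' hU' hVU' => ?_⟩
    rw [← EReal.coe_le_coe_iff, ← hDg]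
    exact le_sSup ⟨V', U', hV', hU', hVU', rfl⟩
  · rintro _ ⟨D₀, rfl, hD₀⟩
    refine sSup_le ?_
    rintro _ ⟨V', U', hV', hU', hVU', rfl⟩
    exact EReal.coe_le_coe_iff.2 (hD₀.gaussObj_le hc hd hV' hU' hVU')

end FRBL
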